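/- For every ε > 0 there exists an integer m_ε such that every even multigraph G with m > m_ε edges has pathwidth at most (23/135)·m + ε·m. -/

import Mathlib

/-!
A multigraph is given by a type `V` of vertices, a type `E` of edge indices, and a map
`ends : E → Sym2 V` giving the (unordered) pair of endpoints of each edge.
-/

/-- The multiset of endpoints of an unordered pair (a diagonal pair `s(v,v)`, i.e. a loop,
contributes `v` twice). -/
def Sym2.toMul {V : Type} : Sym2 V → Multiset V :=
  Sym2.lift ⟨fun a b => {a, b}, fun a b => Multiset.pair_comm a b⟩

/-- The degree of a vertex `v` in the multigraph with edges indexed by `E`: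
each loop at `v` contributes `2`, each other edge incident with `v` contributes `1`. -/
def Multigraph.deg {V E : Type} [Fintype E] [DecidableEq V]
    (ends : E → Sym2 V) (v : V) : ℕ :=
  ∑ e : E, Multiset.count v (ends e).toMul

/-- `X` is a path decomposition of the multigraph with endpoint map `ends`:
every vertex appears in a nonempty set of consecutive bags, and both endpoints of every
edge lie in some common bag. -/
def Multigraph.IsPathDecomp {V E : Type} (ends : E → Sym2 V) (r : ℕ)
    (X : Fin (r + 1) → Finset V) : Prop :=
  (∀ v : V, ∃ t, v ∈ X t) ∧
  (∀ (v : V) (a b c : Fin (r + 1)), a ≤ b → b ≤ c → v ∈ X a → v ∈ X c → v ∈ X b) ∧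
  (∀ e : E, ∃ t, ∀ u, u ∈ ends e → u ∈ X t)

/-- The pathwidth of a multigraph: the least `w` such that there is a path decomposition
all of whose bags have at most `w + 1` vertices. -/
noncomputable def Multigraph.pathwidth {V E : Type} (ends : E → Sym2 V) : ℕ :=
  sInf {w : ℕ | ∃ (r : ℕ) (X : Fin (r + 1) → Finset V),
    Multigraph.IsPathDecomp ends r X ∧ ∀ t, (X t).card ≤ w + 1}

section Layouts

open scoped Classical

variable {V : Type}

/-- The neighbours of `v` inside `S`. -/
noncomputable def nbrs (H : SimpleGraph V) (S : Finset V) (v : V) : Finset V :=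
  S.filter (H.Adj v)

/-- The number of neighbours of `v` inside `S`. -/
noncomputable def degIn (H : SimpleGraph V) (S : Finset V) (v : V) : ℕ :=
  (nbrs H S v).card

/-- The number of pairs `(u, w)` of adjacent vertices with `u ∈ S` and `w ∈ T`. -/
noncomputable def crossing (H : SimpleGraph V) (S T : Finset V) : ℕ :=
  ∑ u ∈ S, degIn H T u

/-- The bag at time `t` of the interval representation in which the vertex `v ∈ W` is alive from
time `f v` until the largest time assigned to one of its neighbours. -/
noncomputable def bag (G : SimpleGraph V) (W : Finset V) (f : V → ℕ) (t : ℕ) : Finset V :=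
  W.filter fun v => f v = t ∨ (f v < t ∧ ∃ u ∈ W, G.Adj v u ∧ t ≤ f u)

/-- The graph induced on `W` can be laid out so that all bags have at most `x` vertices. -/
def HasLayout (G : SimpleGraph V) (W : Finset V) (x : ℝ) : Prop :=
  ∃ f : V → ℕ, ∀ t, ((bag G W f t).card : ℝ) ≤ x

/-- `M` is a union of components of the graph induced on `W`. -/
def IsClosedIn (H : SimpleGraph V) (W M : Finset V) : Prop :=
  ∀ u ∈ M, ∀ w ∈ W, w ∉ M → ¬ H.Adj u w

/-- The graph induced on `W` has at most one component. -/
def IsConn (H : SimpleGraph V) (W : Finset V) : Prop :=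
  ∀ M ⊆ W, M.Nonempty → IsClosedIn H W M → M = W

@[simp] lemma mem_nbrs {H : SimpleGraph V} {S : Finset V} {v u : V} :
    u ∈ nbrs H S v ↔ u ∈ S ∧ H.Adj v u := by
  simp [nbrs]

lemma mem_bag {G : SimpleGraph V} {W : Finset V} {f : V → ℕ} {t : ℕ} {v : V} :
    v ∈ bag G W f t ↔ v ∈ W ∧ (f v = t ∨ (f v < t ∧ ∃ u ∈ W, G.Adj v u ∧ t ≤ f u)) := by
  simp [bag]

lemma HasLayout.mono {G : SimpleGraph V} {W : Finset V} {x y : ℝ} (h : HasLayout G W x)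
    (hxy : x ≤ y) : HasLayout G W y := by
  obtain ⟨f, hf⟩ := h
  exact ⟨f, fun t => (hf t).trans hxy⟩

lemma HasLayout.insert {G : SimpleGraph V} {W : Finset V} {x : ℝ} (v : V)
    (h : HasLayout G (W.erase v) x) : HasLayout G W (x + 1) := by
  obtain ⟨f, hf⟩ := h
  refine ⟨Function.update f v 0, fun t => ?_⟩
  have hsub : bag G W (Function.update f v 0) t ⊆ Insert.insert v (bag G (W.erase v) f t) := by
    intro u hu
    rw [mem_bag] at hu
    rw [Finset.mem_insert, mem_bag]
    by_cases huv : u = v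
    · exact Or.inl huv
    · right
      obtain ⟨huW, hu⟩ := hu
      rw [Function.update_of_ne huv] at hu
      refine ⟨Finset.mem_erase.2 ⟨huv, huW⟩, ?_⟩
      rcases hu with hu | ⟨hlt, w, hw, hadj, hle⟩
      · exact Or.inl hu
      · refine Or.inr ⟨hlt, w, ?_, hadj, ?_⟩
        · refine Finset.mem_erase.2 ⟨?_, hw⟩
          rintro rfl
          simp at hle
          omega
        · by_cases hwv : w = v
          · subst hwv
            simp at hle
            omega
          · rwa [Function.update_of_ne hwv] at hle
  have h1 := (Finset.card_le_card hsub).trans (Finset.card_insert_le _ _)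
  have h2 : ((bag G W (Function.update f v 0) t).card : ℝ)
      ≤ ((bag G (W.erase v) f t).card : ℝ) + 1 := by exact_mod_cast h1
  linarith [hf t]

lemma HasLayout.add_card {G : SimpleGraph V} (X : Finset V) :
    ∀ {W : Finset V} {x : ℝ}, HasLayout G (W \ X) x → HasLayout G W (x + X.card) := by
  induction X using Finset.induction_on with
  | empty => intro W x h; simpa using h
  | insert a X ha ih =>
    intro W x h
    have h1 : HasLayout G (W \ X) (x + 1) := by
      apply HasLayout.insert a
      convert h using 1
      ext u
      simp only [Finset.mem_erase, Finset.mem_sdiff, Finset.mem_insert]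
      tauto
    refine (ih h1).mono ?_
    rw [Finset.card_insert_of_notMem ha]
    push_cast
    linarith

lemma HasLayout.union {G : SimpleGraph V} {A B : Finset V} {x : ℝ}
    (hA : HasLayout G A x) (hB : HasLayout G B x)
    (hAB : ∀ u ∈ A, ∀ v ∈ B, ¬ G.Adj u v) : HasLayout G (A ∪ B) x := by
  obtain ⟨f, hf⟩ := hA
  obtain ⟨g, hg⟩ := hB
  set N := A.sup f + 1 with hN
  have hfN : ∀ u ∈ A, f u < N := fun u hu => Nat.lt_succ_of_le (Finset.le_sup (f := f) hu)
  have hBA : ∀ u ∈ B, ∀ v ∈ A, ¬ G.Adj u v := fun u hu v hv h => hAB v hv u hu h.symm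
  set h : V → ℕ := fun v => if v ∈ A then f v else N + g v with hh
  have hhA : ∀ v ∈ A, h v = f v := fun v hv => if_pos hv
  have hhB : ∀ v, v ∉ A → h v = N + g v := fun v hv => if_neg hv
  refine ⟨h, fun t => ?_⟩
  rcases lt_or_ge t N with ht | ht
  · refine le_trans ?_ (hf t)
    exact_mod_cast Finset.card_le_card (by
      intro v hv
      rw [mem_bag] at hv ⊢
      obtain ⟨hvW, hv⟩ := hv
      have hvA : v ∈ A := by
        by_contra hvA
        rw [hhB v hvA] at hv
        omega
      rw [hhA v hvA] at hv
      refine ⟨hvA, ?_⟩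
      rcases hv with hv | ⟨hlt, u, hu, hadj, hle⟩
      · exact Or.inl hv
      · have huA : u ∈ A := by
          by_contra huA
          exact hAB v hvA u ((Finset.mem_union.1 hu).resolve_left huA) hadj
        rw [hhA u huA] at hle
        exact Or.inr ⟨hlt, u, huA, hadj, hle⟩)
  · refine le_trans ?_ (hg (t - N))
    exact_mod_cast Finset.card_le_card (by
      intro v hv
      rw [mem_bag] at hv ⊢
      obtain ⟨hvW, hv⟩ := hv
      have hvA : v ∉ A := by
        intro hvA
        have := hfN v hvA
        rw [hhA v hvA] at hv
        rcases hv with hv | ⟨hlt, u, hu, hadj, hle⟩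
        · omega
        · have huA : u ∈ A := by
            by_contra huA
            exact hAB v hvA u ((Finset.mem_union.1 hu).resolve_left huA) hadj
          have := hfN u huA
          rw [hhA u huA] at hle
          omega
      have hvB := (Finset.mem_union.1 hvW).resolve_left hvA
      rw [hhB v hvA] at hv
      refine ⟨hvB, ?_⟩
      rcases hv with hv | ⟨hlt, u, hu, hadj, hle⟩
      · left; omega
      · have huA : u ∉ A := fun huA => hBA v hvB u huA hadj
        rw [hhB u huA] at hle
        exact Or.inr ⟨by omega, u, (Finset.mem_union.1 hu).resolve_left huA, hadj, by omega⟩)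

lemma exists_nat_injOn (B : Finset V) : ∃ i : V → ℕ, Set.InjOn i B ∧ ∀ v ∈ B, i v < B.card := by
  refine ⟨fun v => if h : v ∈ B then (B.equivFin ⟨v, h⟩ : ℕ) else 0, ?_, ?_⟩
  · intro u hu v hv huv
    have hu' : u ∈ B := hu
    have hv' : v ∈ B := hv
    simp only [hu', hv', dif_pos] at huv
    have := B.equivFin.injective (Fin.ext huv)
    simpa using this
  · intro v hv
    simp only [hv, dif_pos]
    exact (B.equivFin ⟨v, hv⟩).2

lemma HasLayout.of_labelling {G : SimpleGraph V} {A : Finset V} {k : ℕ} (π : V → V)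
    (hadj : ∀ u ∈ A, ∀ v ∈ A, G.Adj u v → π u = π v)
    (hcard : ∀ x, (A.filter fun u => π u = x).card ≤ k) : HasLayout G A k := by
  obtain ⟨i, hi, -⟩ := exists_nat_injOn (A.image π)
  refine ⟨fun v => i (π v), fun t => ?_⟩
  have key : ∀ v ∈ bag G A (fun v => i (π v)) t, v ∈ A ∧ i (π v) = t := by
    intro v hv
    rw [mem_bag] at hv
    obtain ⟨hvA, hv⟩ := hv
    refine ⟨hvA, ?_⟩
    rcases hv with hv | ⟨hlt, u, hu, h, hle⟩
    · exact hv
    · rw [hadj v hvA u hu h] at hlt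
      omega
  rcases (bag G A (fun v => i (π v)) t).eq_empty_or_nonempty with h | ⟨v, hv⟩
  · simp [h]
  · have h1 := key v hv
    have : bag G A (fun v => i (π v)) t ⊆ A.filter fun u => π u = π v := by
      intro u hu
      have h2 := key u hu
      refine Finset.mem_filter.2 ⟨h2.1, hi ?_ ?_ (h2.2.trans h1.2.symm)⟩
      · exact Finset.mem_coe.2 (Finset.mem_image_of_mem π h2.1)
      · exact Finset.mem_coe.2 (Finset.mem_image_of_mem π h1.1)
    exact_mod_cast (Finset.card_le_card this).trans (hcard _)

/-- The graph `G` induced on `A` arises from the graph `H` on the set `W ⊆ A` of core vertices by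
attaching pieces, the fibres of `π` on `A \ W`, each of size at most `k` and each attached to a
clique of `H`. -/
structure Overlay (G H : SimpleGraph V) (k : ℕ) (A W : Finset V) (π : V → V) : Prop where
  sub : W ⊆ A
  adj_core : ∀ u ∈ W, ∀ v ∈ W, G.Adj u v → H.Adj u v
  adj_piece : ∀ u ∈ A \ W, ∀ v ∈ A \ W, G.Adj u v → π u = π v
  clique : ∀ u ∈ A \ W, ∀ v ∈ A \ W, π u = π v → ∀ a ∈ W, ∀ b ∈ W, G.Adj u a → G.Adj v b →
    a ≠ b → H.Adj a b
  size : ∀ x, ((A \ W).filter fun u => π u = x).card ≤ k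
  label : ∀ u ∈ A \ W, π u ∉ W

namespace Overlay

variable {G H : SimpleGraph V} {k : ℕ} {A W : Finset V} {π : V → V}

lemma refl (G : SimpleGraph V) (k : ℕ) (W : Finset V) : Overlay G G k W W id where
  sub := le_rfl
  adj_core := fun _ _ _ _ h => h
  adj_piece := by simp
  clique := by simp
  size := by simp
  label := by simp

lemma restrict (h : Overlay G H k A W π) {A' W' : Finset V} (hA : A' ⊆ A)
    (hW : ∀ v, v ∈ W' ↔ v ∈ W ∧ v ∈ A') : Overlay G H k A' W' π := by
  have hsub : A' \ W' ⊆ A \ W := by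
    intro u hu
    rw [Finset.mem_sdiff, hW] at hu
    exact Finset.mem_sdiff.2 ⟨hA hu.1, fun h => hu.2 ⟨h, hu.1⟩⟩
  have hW' : W' ⊆ W := fun v hv => ((hW v).1 hv).1
  exact
    { sub := fun v hv => ((hW v).1 hv).2
      adj_core := fun u hu v hv => h.adj_core u (hW' hu) v (hW' hv)
      adj_piece := fun u hu v hv => h.adj_piece u (hsub hu) v (hsub hv)
      clique := fun u hu v hv e a ha b hb =>
        h.clique u (hsub hu) v (hsub hv) e a (hW' ha) b (hW' hb)
      size := fun x => (Finset.card_le_card (Finset.filter_subset_filter _ hsub)).trans (h.size x)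
      label := fun u hu hu' => h.label u (hsub hu) (hW' hu') }

lemma layout_pieces (h : Overlay G H k A W π) {B : Finset V} (hB : B ⊆ A \ W) :
    HasLayout G B k :=
  HasLayout.of_labelling π (fun u hu v hv => h.adj_piece u (hB hu) v (hB hv))
    fun x => (Finset.card_le_card (Finset.filter_subset_filter _ hB)).trans (h.size x)

lemma layout (h : Overlay G H k A W π) {x : ℝ} (hH : HasLayout H W x) :
    HasLayout G A (x + k) := by
  obtain ⟨f, hf⟩ := hH
  obtain ⟨i, hi, hiN⟩ := exists_nat_injOn ((A \ W).image π)
  set N := ((A \ W).image π).card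
  set att : V → Finset V := fun l =>
    W.filter fun a => ∃ u ∈ A \ W, π u = l ∧ G.Adj u a with hatt
  set top : V → ℕ := fun l => (att l).sup f with htop
  set g : V → ℕ := fun v => if v ∈ W then (N + 1) * f v else (N + 1) * top (π v) + 1 + i (π v)
    with hg
  have hgW : ∀ v ∈ W, g v = (N + 1) * f v := fun v hv => if_pos hv
  have hgP : ∀ v, v ∉ W → g v = (N + 1) * top (π v) + 1 + i (π v) := fun v hv => if_neg hv
  have hiN' : ∀ v ∈ A \ W, i (π v) < N := fun v hv => hiN _ (Finset.mem_image_of_mem π hv)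
  have hmem : ∀ u ∈ A \ W, ∀ a ∈ W, G.Adj u a → a ∈ att (π u) := fun u hu a ha hadj =>
    Finset.mem_filter.2 ⟨ha, u, hu, rfl, hadj⟩
  refine ⟨g, fun t => ?_⟩
  set q := t / (N + 1) with hq
  set r := t % (N + 1) with hr
  have htqr : t = (N + 1) * q + r := (Nat.div_add_mod t (N + 1)).symm
  have hrN : r < N + 1 := Nat.mod_lt _ (Nat.succ_pos _)
  have hcore : ∀ v ∈ bag G A g t, v ∈ W → v ∈ bag H W f q := by
    intro v hv hvW
    rw [mem_bag, hgW v hvW] at hv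
    obtain ⟨hvA, hv⟩ := hv
    rw [mem_bag]
    refine ⟨hvW, ?_⟩
    have hle : f v ≤ q := by
      by_contra hlt
      have : (N + 1) * (q + 1) ≤ (N + 1) * f v := Nat.mul_le_mul_left _ (by omega)
      rw [Nat.mul_add] at this
      rcases hv with hv | hv <;> omega
    rcases hle.eq_or_lt with heq | hlt
    · exact Or.inl heq
    · refine Or.inr ⟨hlt, ?_⟩
      have hlt' : (N + 1) * (f v + 1) ≤ (N + 1) * q := Nat.mul_le_mul_left _ (by omega)
      rw [Nat.mul_add] at hlt'
      rcases hv with hv | ⟨-, u, huA, hadj, hu⟩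
      · omega
      · by_cases huW : u ∈ W
        · rw [hgW u huW] at hu
          refine ⟨u, huW, h.adj_core v hvW u huW hadj, ?_⟩
          by_contra hcon
          have : (N + 1) * (f u + 1) ≤ (N + 1) * q := Nat.mul_le_mul_left _ (by omega)
          rw [Nat.mul_add] at this
          have hpos : 0 < N + 1 := Nat.succ_pos _
          omega
        · have huP : u ∈ A \ W := Finset.mem_sdiff.2 ⟨huA, huW⟩
          rw [hgP u huW] at hu
          have hiu := hiN' u huP
          have hqt : q ≤ top (π u) := by
            by_contra hcon
            have : (N + 1) * (top (π u) + 1) ≤ (N + 1) * q := Nat.mul_le_mul_left _ (by omega)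
            rw [Nat.mul_add] at this
            omega
          have hne : (att (π u)).Nonempty := ⟨v, hmem u huP v hvW hadj.symm⟩
          obtain ⟨a, ha, hatop⟩ := Finset.exists_mem_eq_sup _ hne f
          rw [hatt, Finset.mem_filter] at ha
          obtain ⟨haW, u', hu', hπ, hadj'⟩ := ha
          have hfa : q ≤ f a := hqt.trans (le_of_eq hatop)
          refine ⟨a, haW, ?_, hfa⟩
          refine h.clique u huP u' hu' hπ.symm v hvW a haW hadj.symm hadj' ?_
          rintro rfl
          omega
  have hpiece : ∀ v ∈ bag G A g t, v ∉ W → v ∈ A \ W ∧ i (π v) + 1 = r := by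
    intro v hv hvW
    rw [mem_bag] at hv
    obtain ⟨hvA, hv⟩ := hv
    have hvP : v ∈ A \ W := Finset.mem_sdiff.2 ⟨hvA, hvW⟩
    refine ⟨hvP, ?_⟩
    have hgt : g v = t := by
      rcases hv with hv | ⟨hlt, u, huA, hadj, hle⟩
      · exact hv
      · exfalso
        by_cases huW : u ∈ W
        · rw [hgW u huW] at hle
          rw [hgP v hvW] at hlt
          have h1 : f u ≤ top (π v) := Finset.le_sup (f := f) (hmem v hvP u huW hadj)
          have : (N + 1) * f u ≤ (N + 1) * top (π v) := Nat.mul_le_mul_left _ h1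
          omega
        · rw [hgP u huW, ← h.adj_piece v hvP u (Finset.mem_sdiff.2 ⟨huA, huW⟩) hadj,
            ← hgP v hvW] at hle
          omega
    have hiv := hiN' v hvP
    rw [hgP v hvW] at hgt
    rw [hr, ← hgt, add_assoc, Nat.mul_add_mod, Nat.mod_eq_of_lt (by omega)]
    omega
  have hfib : ((bag G A g t).filter fun v => v ∉ W).card ≤ k := by
    rcases ((bag G A g t).filter fun v => v ∉ W).eq_empty_or_nonempty with he | ⟨v, hv⟩
    · simp [he]
    · rw [Finset.mem_filter] at hv
      have h1 := hpiece v hv.1 hv.2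
      refine (Finset.card_le_card ?_).trans (h.size (π v))
      intro u hu
      rw [Finset.mem_filter] at hu
      have h2 := hpiece u hu.1 hu.2
      refine Finset.mem_filter.2 ⟨h2.1, hi ?_ ?_ (by omega)⟩
      · exact Finset.mem_coe.2 (Finset.mem_image_of_mem π h2.1)
      · exact Finset.mem_coe.2 (Finset.mem_image_of_mem π h1.1)
  have hcore' : ((bag G A g t).filter fun v => v ∈ W).card ≤ (bag H W f q).card := by
    refine Finset.card_le_card fun v hv => ?_
    rw [Finset.mem_filter] at hv
    exact hcore v hv.1 hv.2
  have hsum := Finset.card_filter_add_card_filter_not (s := bag G A g t) (fun v => v ∈ W)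
  have : ((bag G A g t).card : ℝ) ≤ ((bag H W f q).card : ℝ) + k := by
    exact_mod_cast (by omega : (bag G A g t).card ≤ (bag H W f q).card + k)
  linarith [hf q]

/-- The core vertices of `M` together with all pieces attached to them. -/
noncomputable def part (G : SimpleGraph V) (A W : Finset V) (π : V → V) (M : Finset V) :
    Finset V :=
  M ∪ (A \ W).filter fun u => ∃ v ∈ A \ W, π v = π u ∧ ∃ a ∈ M, G.Adj v a

lemma mem_part {M : Finset V} {u : V} : u ∈ part G A W π M ↔
    u ∈ M ∨ ((u ∈ A ∧ u ∉ W) ∧ ∃ v, (v ∈ A ∧ v ∉ W) ∧ π v = π u ∧ ∃ a ∈ M, G.Adj v a) := by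
  simp [part]

lemma part_subset (h : Overlay G H k A W π) {M : Finset V} (hM : M ⊆ W) :
    part G A W π M ⊆ A := by
  intro u hu
  rcases mem_part.1 hu with hu | hu
  · exact h.sub (hM hu)
  · exact hu.1.1

lemma part_overlay (h : Overlay G H k A W π) {M : Finset V} (hM : M ⊆ W) :
    Overlay G H k (part G A W π M) M π :=
  h.restrict (h.part_subset hM) fun _ =>
    ⟨fun hv => ⟨hM hv, mem_part.2 (Or.inl hv)⟩, fun hv => (mem_part.1 hv.2).resolve_right
      fun h' => h'.1.2 hv.1⟩

lemma compl_part_overlay (h : Overlay G H k A W π) (M : Finset V) :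
    Overlay G H k (A \ part G A W π M) (W \ M) π :=
  h.restrict Finset.sdiff_subset fun v => by
    rw [Finset.mem_sdiff, Finset.mem_sdiff]
    constructor
    · rintro ⟨hvW, hvM⟩
      refine ⟨hvW, h.sub hvW, fun hv => ?_⟩
      rcases mem_part.1 hv with hv | hv
      · exact hvM hv
      · exact hv.1.2 hvW
    · rintro ⟨hvW, -, hv⟩
      exact ⟨hvW, fun hvM => hv (mem_part.2 (Or.inl hvM))⟩

lemma part_not_adj (h : Overlay G H k A W π) {M : Finset V} (hM : M ⊆ W)
    (hcl : IsClosedIn H W M) :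
    ∀ u ∈ part G A W π M, ∀ v ∈ A \ part G A W π M, ¬ G.Adj u v := by
  intro u hu v hv hadj
  rw [Finset.mem_sdiff, mem_part] at hv
  push Not at hv
  obtain ⟨hvA, hvM, hv⟩ := hv
  rcases mem_part.1 hu with hu | ⟨⟨huA, huW⟩, w, ⟨hwA, hwW⟩, hwu, a, haM, hwa⟩
  · by_cases hvW : v ∈ W
    · exact hcl u hu v hvW hvM (h.adj_core u (hM hu) v hvW hadj)
    · exact hv ⟨hvA, hvW⟩ v ⟨hvA, hvW⟩ rfl u hu hadj.symm
  · by_cases hvW : v ∈ W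
    · refine hcl a haM v hvW hvM ?_
      refine h.clique w (Finset.mem_sdiff.2 ⟨hwA, hwW⟩) u (Finset.mem_sdiff.2 ⟨huA, huW⟩) hwu
        a (hM haM) v hvW hwa hadj ?_
      rintro rfl
      exact hvM haM
    · refine hv ⟨hvA, hvW⟩ w ⟨hwA, hwW⟩ ?_ a haM hwa
      rw [hwu]
      exact h.adj_piece u (Finset.mem_sdiff.2 ⟨huA, huW⟩) v (Finset.mem_sdiff.2 ⟨hvA, hvW⟩) hadj

end Overlay

lemma IsClosedIn.trans {H : SimpleGraph V} {W M K : Finset V} (hM : IsClosedIn H W M)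
    (hK : IsClosedIn H M K) (hKM : K ⊆ M) : IsClosedIn H W K := by
  intro u hu w hw hwK
  by_cases hwM : w ∈ M
  · exact hK u hu w hwM hwK
  · exact hM u (hKM hu) w hw hwM

lemma IsClosedIn.compl {H : SimpleGraph V} {W M : Finset V} (hM : IsClosedIn H W M) :
    IsClosedIn H W (W \ M) := by
  intro u hu w hw hwM hadj
  rw [Finset.mem_sdiff] at hu hwM
  have : w ∈ M := by tauto
  exact hM w this u hu.1 hu.2 hadj.symm

lemma Overlay.layout_of_components {G H : SimpleGraph V} {k : ℕ} {π : V → V} {y : ℝ}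
    (hk : (k : ℝ) ≤ y) : ∀ (n : ℕ) {A W : Finset V}, W.card = n → Overlay G H k A W π →
    (∀ M ⊆ W, M.Nonempty → IsClosedIn H W M → IsConn H M → ∀ B ⊆ A, Overlay G H k B M π →
      HasLayout G B y) → HasLayout G A y := by
  intro n
  induction n using Nat.strong_induction_on with
  | _ n ih =>
    intro A W hn hO hcomp
    rcases W.eq_empty_or_nonempty with rfl | hne
    · exact (hO.layout_pieces (by simp)).mono hk
    · by_cases hconn : IsConn H W
      · exact hcomp W le_rfl hne (fun u _ w hw hw' => absurd hw hw') hconn A le_rfl hO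
      · unfold IsConn at hconn
        push Not at hconn
        obtain ⟨M, hMW, hMne, hMcl, hMne'⟩ := hconn
        have hlt : M.card < W.card := Finset.card_lt_card (hMW.ssubset_of_ne hMne')
        have hlt' : (W \ M).card < W.card := by
          rw [Finset.card_sdiff_of_subset hMW]
          have := Finset.card_pos.2 hMne
          omega
        have h1 : HasLayout G (Overlay.part G A W π M) y := by
          refine ih M.card (hn ▸ hlt) rfl (hO.part_overlay hMW) ?_
          intro K hK hKne hKcl hKconn B hB hOB
          exact hcomp K (hK.trans hMW) hKne (hMcl.trans hKcl hK) hKconn B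
            (hB.trans (hO.part_subset hMW)) hOB
        have h2 : HasLayout G (A \ Overlay.part G A W π M) y := by
          refine ih (W \ M).card (hn ▸ hlt') rfl (hO.compl_part_overlay M) ?_
          intro K hK hKne hKcl hKconn B hB hOB
          exact hcomp K (hK.trans Finset.sdiff_subset) hKne
            (hMcl.compl.trans hKcl hK) hKconn B (hB.trans Finset.sdiff_subset) hOB
        have := h1.union h2 (hO.part_not_adj hMW hMcl)
        rwa [Finset.union_sdiff_of_subset (hO.part_subset hMW)] at this

section Counting

variable {H : SimpleGraph V}

lemma degIn_mono {S T : Finset V} (h : S ⊆ T) (v : V) : degIn H S v ≤ degIn H T v :=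
  Finset.card_le_card (Finset.filter_subset_filter _ h)

lemma degIn_union {S T : Finset V} (h : Disjoint S T) (v : V) :
    degIn H (S ∪ T) v = degIn H S v + degIn H T v := by
  unfold degIn nbrs
  rw [Finset.filter_union, Finset.card_union_of_disjoint (Finset.disjoint_filter_filter h)]

lemma degIn_sdiff {S T : Finset V} (h : S ⊆ T) (v : V) :
    degIn H S v + degIn H (T \ S) v = degIn H T v := by
  rw [← degIn_union Finset.disjoint_sdiff, Finset.union_sdiff_of_subset h]

lemma one_le_degIn {S : Finset V} {v u : V} (hu : u ∈ S) (h : H.Adj v u) : 1 ≤ degIn H S v :=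
  Finset.card_pos.2 ⟨u, mem_nbrs.2 ⟨hu, h⟩⟩

lemma exists_of_one_le_degIn {S : Finset V} {v : V} (h : 1 ≤ degIn H S v) :
    ∃ u ∈ S, H.Adj v u := by
  obtain ⟨u, hu⟩ := Finset.card_pos.1 h
  exact ⟨u, mem_nbrs.1 hu⟩

lemma crossing_comm (S T : Finset V) : crossing H S T = crossing H T S := by
  unfold crossing degIn nbrs
  simp only [Finset.card_filter]
  rw [Finset.sum_comm]
  simp only [H.adj_comm]

lemma crossing_union_left {S S' : Finset V} (h : Disjoint S S') (T : Finset V) :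
    crossing H (S ∪ S') T = crossing H S T + crossing H S' T :=
  Finset.sum_union h

lemma crossing_union_right (S : Finset V) {T T' : Finset V} (h : Disjoint T T') :
    crossing H S (T ∪ T') = crossing H S T + crossing H S T' := by
  rw [crossing_comm, crossing_union_left h, crossing_comm T, crossing_comm T']

lemma crossing_sdiff_left {S S' : Finset V} (h : S ⊆ S') (T : Finset V) :
    crossing H S T + crossing H (S' \ S) T = crossing H S' T := by
  rw [← crossing_union_left Finset.disjoint_sdiff, Finset.union_sdiff_of_subset h]

lemma crossing_sdiff_right (S : Finset V) {T T' : Finset V} (h : T ⊆ T') :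
    crossing H S T + crossing H S (T' \ T) = crossing H S T' := by
  rw [← crossing_union_right _ Finset.disjoint_sdiff, Finset.union_sdiff_of_subset h]

lemma crossing_singleton (v : V) (T : Finset V) : crossing H {v} T = degIn H T v := by
  simp [crossing]

lemma crossing_sdiff_compl {W T U : Finset V} (hT : T ⊆ W) (hU : U ⊆ T) :
    crossing H (T \ U) (W \ (T \ U)) + crossing H U (W \ T) =
      crossing H T (W \ T) + crossing H U (T \ U) := by
  have h1 : W \ (T \ U) = (W \ T) ∪ U := by
    ext v
    have h1 := @hT v
    have h2 := @hU v
    simp only [Finset.mem_sdiff, Finset.mem_union]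
    tauto
  have h2 : Disjoint (W \ T) U := Finset.disjoint_left.2 fun v hv hvU =>
    (Finset.mem_sdiff.1 hv).2 (hU hvU)
  rw [h1, crossing_union_right _ h2, ← crossing_sdiff_left hU (W \ T), crossing_comm (T \ U) U]
  ring

end Counting

section Connectivity

variable {H : SimpleGraph V}

lemma IsClosedIn.inter {D A M : Finset V} (h : IsClosedIn H D M) (hA : A ⊆ D) :
    IsClosedIn H A (M ∩ A) := by
  intro u hu w hw hwM
  exact h u (Finset.mem_inter.1 hu).1 w (hA hw) fun h' => hwM (Finset.mem_inter.2 ⟨h', hw⟩)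

lemma IsConn.subset_or_disjoint {D A M : Finset V} (hA : IsConn H A) (hAD : A ⊆ D)
    (hM : IsClosedIn H D M) : A ⊆ M ∨ Disjoint M A := by
  rcases (M ∩ A).eq_empty_or_nonempty with h | h
  · exact Or.inr (Finset.disjoint_iff_inter_eq_empty.2 h)
  · exact Or.inl (Finset.inter_eq_right.1 (hA _ Finset.inter_subset_right h (hM.inter hAD)))

lemma isConn_singleton (v : V) : IsConn H {v} := fun _ hM hne _ =>
  (Finset.subset_singleton_iff.1 hM).resolve_left hne.ne_empty

lemma IsConn.union {A B : Finset V} (hA : IsConn H A) (hB : IsConn H B) {a b : V}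
    (ha : a ∈ A) (hb : b ∈ B) (hab : H.Adj a b) : IsConn H (A ∪ B) := by
  intro M hM hne hcl
  have h1 := hA.subset_or_disjoint Finset.subset_union_left hcl
  have h2 := hB.subset_or_disjoint Finset.subset_union_right hcl
  rcases h1 with h1 | h1 <;> rcases h2 with h2 | h2
  · exact hM.antisymm (Finset.union_subset h1 h2)
  · exact absurd hab (hcl a (h1 ha) b (Finset.mem_union_right _ hb)
      fun h => Finset.disjoint_left.1 h2 h hb)
  · exact absurd hab.symm (hcl b (h2 hb) a (Finset.mem_union_left _ ha)
      fun h => Finset.disjoint_left.1 h1 h ha)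
  · obtain ⟨v, hv⟩ := hne
    rcases Finset.mem_union.1 (hM hv) with h | h
    · exact absurd h (Finset.disjoint_left.1 h1 hv)
    · exact absurd h (Finset.disjoint_left.1 h2 hv)

lemma IsConn.union_biUnion {ι : Type} {P : Finset V} (hP : IsConn H P) (R : ι → Finset V)
    (I : Finset ι) (hR : ∀ i ∈ I, IsConn H (R i) ∧ ∃ a ∈ P, ∃ b ∈ R i, H.Adj a b) :
    IsConn H (P ∪ I.biUnion R) := by
  induction I using Finset.induction_on with
  | empty => simpa using hP
  | insert i I _ ih =>
    have h1 := ih fun j hj => hR j (Finset.mem_insert_of_mem hj)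
    obtain ⟨h2, a, ha, b, hb, hab⟩ := hR i (Finset.mem_insert_self _ _)
    have := h1.union h2 (Finset.mem_union_left _ ha) hb hab
    rwa [Finset.biUnion_insert, Finset.union_left_comm, Finset.union_comm]

lemma IsConn.two_mul_card_le {P : Finset V} (hP : IsConn H P) :
    2 * P.card ≤ crossing H P P + 2 := by
  rcases P.eq_empty_or_nonempty with rfl | ⟨v, hv⟩
  · simp
  · have key : ∀ j, j + 1 ≤ P.card → ∃ Q ⊆ P, Q.card = j + 1 ∧
        2 * Q.card ≤ crossing H Q Q + 2 := by
      intro j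
      induction j with
      | zero => exact fun _ => ⟨{v}, by simpa using hv, by simp, by simp⟩
      | succ j ih =>
        intro hj
        obtain ⟨Q, hQP, hQ, hQe⟩ := ih (by omega)
        have hncl : ¬ IsClosedIn H P Q := by
          intro hcl
          have := hP Q hQP (Finset.card_pos.1 (by omega)) hcl
          rw [this] at hQ
          omega
        unfold IsClosedIn at hncl
        push Not at hncl
        obtain ⟨u, hu, w, hw, hwQ, huw⟩ := hncl
        have hd : Disjoint Q {w} := by simpa using hwQ
        refine ⟨Q ∪ {w}, Finset.union_subset hQP (by simpa using hw), ?_, ?_⟩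
        · rw [Finset.card_union_of_disjoint hd, hQ, Finset.card_singleton]
        · rw [Finset.card_union_of_disjoint hd, crossing_union_left hd, crossing_union_right _ hd,
            crossing_union_right _ hd, crossing_comm Q {w}, crossing_singleton,
            Finset.card_singleton]
          have := one_le_degIn hu huw.symm
          omega
    obtain ⟨Q, hQP, hQ, hQe⟩ := key (P.card - 1)
      (by have := Finset.card_pos.2 ⟨v, hv⟩; omega)
    have : Q = P := Finset.eq_of_subset_of_card_le hQP (by omega)
    rwa [this] at hQe

lemma IsConn.eq_of_mem {D R R' : Finset V} (hR : IsConn H R) (hR' : IsConn H R')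
    (hRD : R ⊆ D) (hRD' : R' ⊆ D) (hcl : IsClosedIn H D R) (hcl' : IsClosedIn H D R') {u : V}
    (hu : u ∈ R) (hu' : u ∈ R') : R = R' := by
  refine Finset.Subset.antisymm ?_ ?_
  · exact (hR.subset_or_disjoint hRD hcl').resolve_right fun h => Finset.disjoint_left.1 h hu' hu
  · exact (hR'.subset_or_disjoint hRD' hcl).resolve_right fun h => Finset.disjoint_left.1 h hu hu'

lemma exists_connected_set {D : Finset V} {v : V} (hv : v ∈ D) (k : ℕ) :
    ∃ P ⊆ D, v ∈ P ∧ IsConn H P ∧ P.card ≤ k + 1 ∧ (P.card = k + 1 ∨ IsClosedIn H D P) := by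
  induction k with
  | zero => exact ⟨{v}, by simpa using hv, by simp, isConn_singleton v, by simp, by simp⟩
  | succ k ih =>
    obtain ⟨P, hPD, hvP, hP, hPk, hcl⟩ := ih
    by_cases h : IsClosedIn H D P
    · exact ⟨P, hPD, hvP, hP, by omega, Or.inr h⟩
    · have hPk' := hcl.resolve_right h
      unfold IsClosedIn at h
      push Not at h
      obtain ⟨u, hu, w, hw, hwP, huw⟩ := h
      have hd : Disjoint P {w} := by simpa using hwP
      have hc : (P ∪ {w}).card = k + 1 + 1 := by
        rw [Finset.card_union_of_disjoint hd, hPk', Finset.card_singleton]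
      exact ⟨P ∪ {w}, Finset.union_subset hPD (by simpa using hw), Finset.mem_union_left _ hvP,
        hP.union (isConn_singleton w) hu (Finset.mem_singleton_self w) huw, hc.le, Or.inl hc⟩

/-- A graph of maximum degree at most `3` is partitioned into few connected pieces of bounded
size and some components of bounded size. -/
lemma exists_pieces (k : ℕ) (hk : 1 ≤ k) : ∀ (n : ℕ) (D : Finset V), D.card = n →
    (∀ v ∈ D, degIn H D v ≤ 3) →
    ∃ Q : Finset (Finset V), (∀ P ∈ Q, P ⊆ D ∧ P.card ≤ k + 3 * k * k ∧ IsConn H P) ∧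
      (∀ P ∈ Q, ∀ P' ∈ Q, P ≠ P' → Disjoint P P') ∧ Q.card * k ≤ D.card ∧
      ∀ v ∈ D, (∀ P ∈ Q, v ∉ P) → ∃ R ⊆ D, v ∈ R ∧ R.card ≤ k ∧ IsConn H R ∧
        IsClosedIn H D R ∧ ∀ P ∈ Q, Disjoint R P := by
  intro n
  induction n using Nat.strong_induction_on with
  | _ n ih =>
    intro D hD hdeg
    by_cases hsmall : ∀ v ∈ D, ∃ R ⊆ D, v ∈ R ∧ R.card ≤ k ∧ IsConn H R ∧ IsClosedIn H D R
    · refine ⟨∅, by simp, by simp, by simp, fun v hv _ => ?_⟩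
      obtain ⟨R, h1, h2, h3, h4, h5⟩ := hsmall v hv
      exact ⟨R, h1, h2, h3, h4, h5, by simp⟩
    · push Not at hsmall
      obtain ⟨v, hv, hvR⟩ := hsmall
      obtain ⟨P, hPD, hvP, hP, hPk, hor⟩ := exists_connected_set (H := H) hv (k - 1)
      have hPk' : P.card = k := by
        rcases hor with h | h
        · omega
        · exact absurd h (hvR P hPD hvP (by omega) hP)
      have hcard : (D \ P).card + k = D.card := by
        rw [← hPk', Finset.card_sdiff_add_card_eq_card hPD]
      obtain ⟨Q, hQ, hQd, hQk, hQR⟩ := ih (D \ P).card (by omega) (D \ P) rfl fun u hu =>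
        (degIn_mono Finset.sdiff_subset u).trans (hdeg u (Finset.mem_sdiff.1 hu).1)
      have hR' : ∀ u, ∃ R : Finset V, u ∈ D \ P → (∀ P ∈ Q, u ∉ P) → R ⊆ D \ P ∧ u ∈ R ∧
          R.card ≤ k ∧ IsConn H R ∧ IsClosedIn H (D \ P) R ∧ ∀ P ∈ Q, Disjoint R P := by
        intro u
        by_cases h : u ∈ D \ P ∧ ∀ P ∈ Q, u ∉ P
        · obtain ⟨R, hR⟩ := hQR u h.1 h.2
          exact ⟨R, fun _ _ => hR⟩
        · exact ⟨∅, fun h1 h2 => absurd ⟨h1, h2⟩ h⟩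
      choose R hR using hR'
      set B := (P.biUnion (nbrs H D)).filter fun u => u ∉ P ∧ ∀ P ∈ Q, u ∉ P with hB
      have hBmem : ∀ u, u ∈ B ↔ (∃ a ∈ P, u ∈ D ∧ H.Adj a u) ∧ u ∉ P ∧ ∀ P ∈ Q, u ∉ P := by
        intro u
        simp [hB]
      have hBR : ∀ u ∈ B, R u ⊆ D \ P ∧ u ∈ R u ∧
          (R u).card ≤ k ∧ IsConn H (R u) ∧ IsClosedIn H (D \ P) (R u) ∧
          ∀ P ∈ Q, Disjoint (R u) P := by
        intro u hu
        obtain ⟨⟨a, ha, huD, hadj⟩, huP, huQ⟩ := (hBmem u).1 hu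
        exact hR u (Finset.mem_sdiff.2 ⟨huD, huP⟩) huQ
      have hBcard : B.card ≤ 3 * k := by
        refine (Finset.card_filter_le _ _).trans (Finset.card_biUnion_le.trans ?_)
        refine (Finset.sum_le_card_nsmul P _ 3 fun a ha => hdeg a (hPD ha)).trans ?_
        rw [hPk', smul_eq_mul]
        omega
      set P' := P ∪ B.biUnion R with hP'
      have hP'Q : ∀ A ∈ Q, Disjoint P' A := by
        intro A hA
        rw [hP', Finset.disjoint_union_left, Finset.disjoint_biUnion_left]
        refine ⟨?_, fun u hu => (hBR u hu).2.2.2.2.2 A hA⟩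
        exact Finset.disjoint_sdiff.mono_right (hQ A hA).1
      have hP'notin : P' ∉ Q := by
        intro h
        have := hP'Q P' h
        rw [disjoint_self] at this
        have h1 : v ∈ P' := Finset.mem_union_left _ hvP
        rw [this] at h1
        simp at h1
      refine ⟨insert P' Q, ?_, ?_, ?_, ?_⟩
      · intro A hA
        rcases Finset.mem_insert.1 hA with rfl | hA
        · refine ⟨Finset.union_subset hPD (Finset.biUnion_subset.2 fun u hu =>
            (hBR u hu).1.trans Finset.sdiff_subset), ?_, ?_⟩
          · refine (Finset.card_union_le _ _).trans ?_
            have h1 : (B.biUnion R).card ≤ B.card * k :=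
              Finset.card_biUnion_le_card_mul _ _ _ fun u hu => (hBR u hu).2.2.1
            have h2 : B.card * k ≤ 3 * k * k := Nat.mul_le_mul_right _ hBcard
            omega
          · refine hP.union_biUnion R B fun u hu => ⟨(hBR u hu).2.2.2.1, ?_⟩
            obtain ⟨⟨a, ha, huD, hadj⟩, -⟩ := (hBmem u).1 hu
            exact ⟨a, ha, u, (hBR u hu).2.1, hadj⟩
        · exact ⟨(hQ A hA).1.trans Finset.sdiff_subset, (hQ A hA).2⟩
      · intro A hA A' hA' hne
        rcases Finset.mem_insert.1 hA with rfl | hA <;>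
          rcases Finset.mem_insert.1 hA' with rfl | hA'
        · exact absurd rfl hne
        · exact hP'Q _ hA'
        · exact (hP'Q _ hA).symm
        · exact hQd A hA A' hA' hne
      · rw [Finset.card_insert_of_notMem hP'notin, Nat.add_mul]
        omega
      · intro u hu huQ
        have huP' : u ∉ P' := huQ P' (Finset.mem_insert_self _ _)
        have huP : u ∉ P := fun h => huP' (Finset.mem_union_left _ h)
        have huQ' : ∀ A ∈ Q, u ∉ A := fun A hA => huQ A (Finset.mem_insert_of_mem hA)
        obtain ⟨h1, h2, h3, h4, h5, h6⟩ := hR u (Finset.mem_sdiff.2 ⟨hu, huP⟩) huQ'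
        have hdisj : ∀ b ∈ B, Disjoint (R u) (R b) := by
          intro b hb
          rw [Finset.disjoint_left]
          intro w hw hwb
          have hb' := hBR b hb
          have := h4.eq_of_mem hb'.2.2.2.1 h1 hb'.1 h5 hb'.2.2.2.2.1 hw hwb
          exact huP' (Finset.mem_union_right _ (Finset.mem_biUnion.2 ⟨b, hb, this ▸ h2⟩))
        refine ⟨R u, h1.trans Finset.sdiff_subset, h2, h3, h4, ?_, ?_⟩
        · intro a ha w hw hwR hadj
          by_cases hwP : w ∈ P
          · have haB : a ∈ B := by
              rw [hBmem]
              have haD := Finset.mem_sdiff.1 (h1 ha)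
              exact ⟨⟨w, hwP, haD.1, hadj.symm⟩, haD.2,
                fun A hA haA => Finset.disjoint_left.1 (h6 A hA) ha haA⟩
            exact Finset.disjoint_left.1 (hdisj a haB) ha (hBR a haB).2.1
          · exact h5 a ha w (Finset.mem_sdiff.2 ⟨hw, hwP⟩) hwR hadj
        · intro A hA
          rcases Finset.mem_insert.1 hA with rfl | hA
          · rw [hP', Finset.disjoint_union_right, Finset.disjoint_biUnion_right]
            exact ⟨Finset.sdiff_disjoint.mono_left h1, hdisj⟩
          · exact h6 A hA

end Connectivity


section Cubic

variable {W T C D : Finset V} {L k : ℕ}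

lemma degIn_eq_zero {S : Finset V} {v : V} (h : ∀ u ∈ S, ¬ H.Adj v u) : degIn H S v = 0 :=
  Finset.card_eq_zero.2 (Finset.eq_empty_of_forall_notMem fun u hu =>
    h u (mem_nbrs.1 hu).1 (mem_nbrs.1 hu).2)

/-- If `U = X ∪ Y` cannot be moved out of `T` so as to decrease the cut, then few edges
leave `X`. -/
lemma card_le_crossing_of_no_gain
    (hC : ∀ v ∈ C, v ∈ T ∧ degIn H T v = 2 ∧ degIn H (W \ T) v = 1)
    (hD : ∀ v ∈ D, v ∈ T ∧ degIn H T v = 3)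
    (hTCD : ∀ v ∈ T, v ∈ C ∨ v ∈ D) (hCD : Disjoint C D)
    (hno : ∀ U ⊆ T, U.card ≤ L → crossing H U (W \ T) ≤ crossing H U (T \ U))
    {X Y Y₀ : Finset V} (hX : X ⊆ D) (hY : Y ⊆ C) (hXY : ∀ v ∈ X, nbrs H C v ⊆ Y)
    (hYnb : ∀ y ∈ Y, ∃ u ∈ X ∪ Y, H.Adj y u) (hY₀ : Y₀ ⊆ Y)
    (hY₀nb : ∀ y ∈ Y₀, nbrs H T y ⊆ X ∪ Y) (hL : (X ∪ Y).card ≤ L) :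
    Y₀.card ≤ crossing H X (D \ X) := by
  have hdisj : Disjoint X Y := (hCD.mono hY hX).symm
  have hUT : X ∪ Y ⊆ T := by
    intro v hv
    rcases Finset.mem_union.1 hv with h | h
    · exact (hD v (hX h)).1
    · exact (hC v (hY h)).1
  have h1 := hno _ hUT hL
  rw [crossing_union_left hdisj, crossing_union_left hdisj] at h1
  have h2 : crossing H Y (W \ T) = Y.card := by
    rw [crossing, Finset.sum_congr rfl fun y hy => (hC y (hY hy)).2.2]
    simp
  have h3 : crossing H X (T \ (X ∪ Y)) ≤ crossing H X (D \ X) := by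
    refine Finset.sum_le_sum fun x hx => Finset.card_le_card fun u hu => ?_
    obtain ⟨hu, hxu⟩ := mem_nbrs.1 hu
    obtain ⟨huT, huU⟩ := Finset.mem_sdiff.1 hu
    rw [Finset.mem_union, not_or] at huU
    refine mem_nbrs.2 ⟨Finset.mem_sdiff.2 ⟨?_, huU.1⟩, hxu⟩
    exact (hTCD u huT).resolve_left fun huC => huU.2 (hXY x hx (mem_nbrs.2 ⟨huC, hxu⟩))
  have h4 : crossing H (Y \ Y₀) (T \ (X ∪ Y)) ≤ (Y \ Y₀).card := by
    rw [Finset.card_eq_sum_ones]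
    refine Finset.sum_le_sum fun y hy => ?_
    have hyY := (Finset.mem_sdiff.1 hy).1
    have h5 := degIn_sdiff (H := H) hUT y
    rw [(hC y (hY hyY)).2.1] at h5
    obtain ⟨u, hu, hyu⟩ := hYnb y hyY
    have := one_le_degIn hu hyu
    omega
  have h5 : crossing H Y₀ (T \ (X ∪ Y)) = 0 := by
    refine Finset.sum_eq_zero fun y hy => degIn_eq_zero fun u hu hyu => ?_
    obtain ⟨huT, huU⟩ := Finset.mem_sdiff.1 hu
    exact huU (hY₀nb y hy (mem_nbrs.2 ⟨huT, hyu⟩))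
  have h6 := crossing_sdiff_left (H := H) hY₀ (T \ (X ∪ Y))
  have h7 := Finset.card_sdiff_add_card_eq_card hY₀
  omega

lemma exists_closed_part {R : Finset V} {z : V}
    (hD : ∀ v ∈ D, v ∈ T ∧ degIn H T v = 3) (hCT : C ⊆ T)
    (hR : z ∈ C ∨ z ∈ D ∧ R ⊆ D ∧ z ∈ R ∧ R.card ≤ k ∧ IsClosedIn H D R) :
    ∃ X Y : Finset V, X ⊆ D ∧ Y ⊆ C ∧ IsClosedIn H D X ∧ (∀ v ∈ X, nbrs H C v ⊆ Y) ∧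
      (X ∪ Y).card ≤ 4 * k + 1 ∧ z ∈ X ∪ Y ∧ ∀ y ∈ Y, y = z ∨ ∃ u ∈ X, H.Adj y u := by
  rcases hR with hz | ⟨-, hRD, hzR, hRk, hcl⟩
  · refine ⟨∅, {z}, by simp, by simpa using hz, fun u hu => by simp at hu, by simp, ?_, by simp,
      by simp⟩
    simp
  · refine ⟨R, R.biUnion (nbrs H C), hRD, ?_, hcl, fun v hv => Finset.subset_biUnion_of_mem _ hv,
      ?_, Finset.mem_union_left _ hzR, ?_⟩
    · intro y hy
      obtain ⟨u, -, hu⟩ := Finset.mem_biUnion.1 hy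
      exact (mem_nbrs.1 hu).1
    · have h1 := Finset.card_union_le R (R.biUnion (nbrs H C))
      have h2 : (R.biUnion (nbrs H C)).card ≤ R.card * 3 :=
        Finset.card_biUnion_le_card_mul _ _ _ fun v hv =>
          (degIn_mono hCT v).trans (hD v (hRD hv)).2.le
      omega
    · intro y hy
      obtain ⟨u, hu, hyu⟩ := Finset.mem_biUnion.1 hy
      exact Or.inr ⟨u, hu, (mem_nbrs.1 hyu).2.symm⟩

lemma card_le_crossing_of_attached
    (hC : ∀ v ∈ C, v ∈ T ∧ degIn H T v = 2 ∧ degIn H (W \ T) v = 1)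
    (hD : ∀ v ∈ D, v ∈ T ∧ degIn H T v = 3)
    (hTCD : ∀ v ∈ T, v ∈ C ∨ v ∈ D) (hCD : Disjoint C D)
    (hno : ∀ U ⊆ T, U.card ≤ L → crossing H U (W \ T) ≤ crossing H U (T \ U))
    {P J Z : Finset V} (hP : P ⊆ D) (hJ : J ⊆ C)
    (hZ : ∀ z ∈ Z, ∃ X Y : Finset V, X ⊆ D ∧ Y ⊆ C ∧ IsClosedIn H D X ∧
      (∀ v ∈ X, nbrs H C v ⊆ Y) ∧ (X ∪ Y).card ≤ 4 * k + 1 ∧ z ∈ X ∪ Y ∧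
      ∀ y ∈ Y, y = z ∨ ∃ u ∈ X, H.Adj y u)
    (hZJ : ∀ z ∈ Z, ∃ c ∈ J, H.Adj z c) (hJnb : ∀ c ∈ J, nbrs H T c ⊆ P ∪ Z)
    (hL : P.card + 3 * P.card + J.card + Z.card * (4 * k + 1) ≤ L) :
    J.card ≤ crossing H P (D \ P) := by
  choose! sX sY h1 h2 h3 h4 h5 h6 h7 using hZ
  set X := P ∪ Z.biUnion sX with hXdef
  set Y := P.biUnion (nbrs H C) ∪ J ∪ Z.biUnion sY with hYdef
  have hPX : P ⊆ X := Finset.subset_union_left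
  have hJY : J ⊆ Y := fun c hc => Finset.mem_union_left _ (Finset.mem_union_right _ hc)
  have hsX : ∀ z ∈ Z, sX z ⊆ X := fun z hz =>
    (Finset.subset_biUnion_of_mem sX hz).trans Finset.subset_union_right
  have hsY : ∀ z ∈ Z, sY z ⊆ Y := fun z hz =>
    (Finset.subset_biUnion_of_mem sY hz).trans Finset.subset_union_right
  have hZU : Z ⊆ X ∪ Y := fun z hz => Finset.union_subset_union (hsX z hz) (hsY z hz) (h6 z hz)
  have hJU : ∀ c ∈ J, nbrs H T c ⊆ X ∪ Y := fun c hc =>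
    (hJnb c hc).trans (Finset.union_subset (hPX.trans Finset.subset_union_left) hZU)
  have hXD : X ⊆ D := Finset.union_subset hP (Finset.biUnion_subset.2 h1)
  have hYC : Y ⊆ C := by
    refine Finset.union_subset (Finset.union_subset (Finset.biUnion_subset.2 fun v _ => ?_) hJ)
      (Finset.biUnion_subset.2 h2)
    exact Finset.filter_subset _ _
  have key : J.card ≤ crossing H X (D \ X) := by
    refine card_le_crossing_of_no_gain hC hD hTCD hCD hno hXD hYC ?_ ?_ hJY hJU ?_
    · intro v hv
      rcases Finset.mem_union.1 hv with hv | hv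
      · exact (Finset.subset_biUnion_of_mem (nbrs H C) hv).trans
          (Finset.subset_union_left.trans Finset.subset_union_left)
      · obtain ⟨z, hz, hv⟩ := Finset.mem_biUnion.1 hv
        exact (h4 z hz v hv).trans (hsY z hz)
    · intro y hy
      rcases Finset.mem_union.1 hy with hy | hy
      · rcases Finset.mem_union.1 hy with hy | hy
        · obtain ⟨u, hu, hyu⟩ := Finset.mem_biUnion.1 hy
          exact ⟨u, Finset.mem_union_left _ (hPX hu), (mem_nbrs.1 hyu).2.symm⟩
        · have hdeg := (hC y (hJ hy)).2.1
          obtain ⟨u, hu, hyu⟩ := exists_of_one_le_degIn (H := H) (S := T) (v := y) (by omega)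
          exact ⟨u, hJU y hy (mem_nbrs.2 ⟨hu, hyu⟩), hyu⟩
      · obtain ⟨z, hz, hy⟩ := Finset.mem_biUnion.1 hy
        rcases h7 z hz y hy with rfl | ⟨u, hu, hyu⟩
        · obtain ⟨c, hc, hyc⟩ := hZJ y hz
          exact ⟨c, Finset.mem_union_right _ (hJY hc), hyc⟩
        · exact ⟨u, Finset.mem_union_left _ (hsX z hz hu), hyu⟩
    · have hsub : X ∪ Y ⊆ P ∪ P.biUnion (nbrs H C) ∪ J ∪ Z.biUnion fun z => sX z ∪ sY z := by
        intro v
        simp only [hXdef, hYdef, Finset.mem_union, Finset.mem_biUnion]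
        rintro ((h | ⟨z, hz, h⟩) | (h | h) | ⟨z, hz, h⟩)
        · exact Or.inl (Or.inl (Or.inl h))
        · exact Or.inr ⟨z, hz, Or.inl h⟩
        · exact Or.inl (Or.inl (Or.inr h))
        · exact Or.inl (Or.inr h)
        · exact Or.inr ⟨z, hz, Or.inr h⟩
      have c0 := Finset.card_le_card hsub
      have c1 := Finset.card_union_le (P ∪ P.biUnion (nbrs H C) ∪ J)
        (Z.biUnion fun z => sX z ∪ sY z)
      have c2 := Finset.card_union_le (P ∪ P.biUnion (nbrs H C)) J
      have c3 := Finset.card_union_le P (P.biUnion (nbrs H C))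
      have c4 : (P.biUnion (nbrs H C)).card ≤ P.card * 3 :=
        Finset.card_biUnion_le_card_mul _ _ _ fun v hv =>
          (degIn_mono (fun u hu => (hC u hu).1) v).trans (hD v (hP hv)).2.le
      have c5 : (Z.biUnion fun z => sX z ∪ sY z).card ≤ Z.card * (4 * k + 1) :=
        Finset.card_biUnion_le_card_mul _ _ _ h5
      omega
  refine key.trans ?_
  rw [← crossing_sdiff_left hPX (D \ X)]
  have hzero : crossing H (X \ P) (D \ X) = 0 := by
    refine Finset.sum_eq_zero fun u hu => degIn_eq_zero fun w hw => ?_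
    obtain ⟨huX, huP⟩ := Finset.mem_sdiff.1 hu
    obtain ⟨hwD, hwX⟩ := Finset.mem_sdiff.1 hw
    obtain ⟨z, hz, hu⟩ := Finset.mem_biUnion.1 ((Finset.mem_union.1 huX).resolve_left huP)
    exact h3 z hz u hu w hwD fun h => hwX (hsX z hz h)
  rw [hzero, add_zero]
  exact Finset.sum_le_sum fun u _ => degIn_mono (Finset.sdiff_subset_sdiff subset_rfl hPX) u

/-- If no small set can be moved out of `T` so as to decrease the cut, then the cut is small. -/
lemma three_mul_crossing_le (hk : 1 ≤ k) (hdeg : ∀ v ∈ W, degIn H W v = 3) (hTW : T ⊆ W)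
    (hL : (7 + 6 * (4 * k + 1)) * (k + 3 * k * k) ≤ L)
    (hno : ∀ U ⊆ T, U.card ≤ L → crossing H U (W \ T) ≤ crossing H U (T \ U)) :
    3 * k * crossing H T (W \ T) ≤ (k + 2) * T.card := by
  have hLpos : 1 ≤ k + 3 * k * k := by omega
  have hL1 : 7 + 6 * (4 * k + 1) ≤ L := le_trans (Nat.le_mul_of_pos_right _ hLpos) hL
  have hsplit : ∀ v ∈ T, degIn H T v + degIn H (W \ T) v = 3 := fun v hv => by
    rw [degIn_sdiff hTW, hdeg v (hTW hv)]
  have hone : ∀ v ∈ T, degIn H (W \ T) v ≤ 1 := by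
    intro v hv
    have h1 := hno {v} (by simpa using hv) (by simp; omega)
    rw [crossing_singleton, crossing_singleton] at h1
    have h2 := degIn_mono (H := H) (Finset.sdiff_subset (s := T) (t := {v})) v
    have h3 := hsplit v hv
    omega
  set C := T.filter fun v => degIn H (W \ T) v = 1 with hCdef
  set D := T.filter fun v => ¬ degIn H (W \ T) v = 1 with hDdef
  have hCT : C ⊆ T := Finset.filter_subset _ _
  have hC : ∀ v ∈ C, v ∈ T ∧ degIn H T v = 2 ∧ degIn H (W \ T) v = 1 := by
    intro v hv
    obtain ⟨h1, h2⟩ := Finset.mem_filter.1 hv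
    have := hsplit v h1
    exact ⟨h1, by omega, h2⟩
  have hD : ∀ v ∈ D, v ∈ T ∧ degIn H T v = 3 := by
    intro v hv
    obtain ⟨h1, h2⟩ := Finset.mem_filter.1 hv
    have := hsplit v h1
    have := hone v h1
    exact ⟨h1, by omega⟩
  have hTCD : ∀ v ∈ T, v ∈ C ∨ v ∈ D := by
    intro v hv
    by_cases h : degIn H (W \ T) v = 1
    · exact Or.inl (Finset.mem_filter.2 ⟨hv, h⟩)
    · exact Or.inr (Finset.mem_filter.2 ⟨hv, h⟩)
  have hCD : Disjoint C D := Finset.disjoint_filter_filter_not _ _ _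
  have hcard : C.card + D.card = T.card := Finset.card_filter_add_card_filter_not _
  have hcut : crossing H T (W \ T) = C.card := by
    rw [hCdef, Finset.card_filter]
    refine Finset.sum_congr rfl fun v hv => ?_
    have := hone v hv
    split_ifs <;> omega
  have hDT : D ⊆ T := Finset.filter_subset _ _
  obtain ⟨Q, hQ, hQd, hQk, hout⟩ := exists_pieces (H := H) k hk _ D rfl
    fun v hv => (degIn_mono hDT v).trans (hD v hv).2.le
  set B := Q.biUnion id with hBdef
  have hBD : B ⊆ D := Finset.biUnion_subset.2 fun P hP => (hQ P hP).1
  have hZ : ∀ z ∈ T \ B, ∃ X Y : Finset V, X ⊆ D ∧ Y ⊆ C ∧ IsClosedIn H D X ∧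
      (∀ v ∈ X, nbrs H C v ⊆ Y) ∧ (X ∪ Y).card ≤ 4 * k + 1 ∧ z ∈ X ∪ Y ∧
      ∀ y ∈ Y, y = z ∨ ∃ u ∈ X, H.Adj y u := by
    intro z hz
    obtain ⟨hzT, hzB⟩ := Finset.mem_sdiff.1 hz
    rcases hTCD z hzT with hzC | hzD
    · exact exists_closed_part (R := ∅) hD hCT (Or.inl hzC)
    · obtain ⟨R, hRD, hzR, hRk, -, hcl, -⟩ := hout z hzD fun P hP hzP =>
        hzB (Finset.mem_biUnion.2 ⟨P, hP, hzP⟩)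
      exact exists_closed_part hD hCT (Or.inr ⟨hzD, hRD, hzR, hRk, hcl⟩)
  have hCB : ∀ c ∈ C, 1 ≤ degIn H B c := by
    intro c hc
    by_contra hlt
    have h0 : ∀ u ∈ B, ¬ H.Adj c u := fun u hu hcu => hlt (one_le_degIn hu hcu)
    have h1 := card_le_crossing_of_attached (k := k) (P := ∅) (J := {c}) (Z := nbrs H T c)
      hC hD hTCD hCD hno (by simp) (by simpa using hc) ?_ ?_ ?_ ?_
    · simp [crossing] at h1
    · intro z hz
      obtain ⟨hzT, hcz⟩ := mem_nbrs.1 hz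
      exact hZ z (Finset.mem_sdiff.2 ⟨hzT, fun h => h0 z h hcz⟩)
    · intro z hz
      exact ⟨c, by simp, (mem_nbrs.1 hz).2.symm⟩
    · simp
    · have : (nbrs H T c).card = 2 := (hC c hc).2.1
      rw [this]
      simp
      omega
  set J : Finset V → Finset V := fun P => C.filter fun c => 1 ≤ degIn H P c ∧ degIn H B c = 1
    with hJdef
  have hmain : ∀ P ∈ Q, (J P).card + crossing H P C ≤ P.card + 2 := by
    intro P hPQ
    obtain ⟨hPD, hPk, hPc⟩ := hQ P hPQ
    have hPB : P ⊆ B := Finset.subset_biUnion_of_mem id hPQ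
    have hJC : J P ⊆ C := Finset.filter_subset _ _
    have hJP : (J P).card ≤ P.card * 3 := by
      refine le_trans (Finset.card_le_card (t := P.biUnion (nbrs H C)) ?_)
        (Finset.card_biUnion_le_card_mul _ _ _ fun v hv =>
          (degIn_mono hCT v).trans (hD v (hPD hv)).2.le)
      intro c hc
      obtain ⟨hcC, hc1, -⟩ := Finset.mem_filter.1 hc
      obtain ⟨u, hu, hcu⟩ := exists_of_one_le_degIn hc1
      exact Finset.mem_biUnion.2 ⟨u, hu, mem_nbrs.2 ⟨hcC, hcu.symm⟩⟩
    have h1 : (J P).card ≤ crossing H P (D \ P) := by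
      refine card_le_crossing_of_attached (k := k) (Z := (J P).biUnion (nbrs H (T \ B)))
        hC hD hTCD hCD hno hPD hJC ?_ ?_ ?_ ?_
      · intro z hz
        obtain ⟨c, -, hz⟩ := Finset.mem_biUnion.1 hz
        exact hZ z (mem_nbrs.1 hz).1
      · intro z hz
        obtain ⟨c, hc, hz⟩ := Finset.mem_biUnion.1 hz
        exact ⟨c, hc, (mem_nbrs.1 hz).2.symm⟩
      · intro c hc u hu
        obtain ⟨huT, hcu⟩ := mem_nbrs.1 hu
        obtain ⟨hcC, hc1, hc2⟩ := Finset.mem_filter.1 hc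
        by_cases huB : u ∈ B
        · obtain ⟨u', hu', hcu'⟩ := exists_of_one_le_degIn hc1
          have : u = u' := Finset.card_le_one.1 hc2.le u (mem_nbrs.2 ⟨huB, hcu⟩) u'
            (mem_nbrs.2 ⟨hPB hu', hcu'⟩)
          exact Finset.mem_union_left _ (this ▸ hu')
        · exact Finset.mem_union_right _ (Finset.mem_biUnion.2
            ⟨c, hc, mem_nbrs.2 ⟨Finset.mem_sdiff.2 ⟨huT, huB⟩, hcu⟩⟩)
      · have hZc : ((J P).biUnion (nbrs H (T \ B))).card ≤ (J P).card * 2 :=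
          Finset.card_biUnion_le_card_mul _ _ _ fun c hc =>
            (degIn_mono Finset.sdiff_subset c).trans (hC c (hJC hc)).2.1.le
        refine le_trans ?_ hL
        calc P.card + 3 * P.card + (J P).card +
              ((J P).biUnion (nbrs H (T \ B))).card * (4 * k + 1)
            ≤ P.card + 3 * P.card + P.card * 3 + (P.card * 3 * 2) * (4 * k + 1) := by
              gcongr
              exact hZc.trans (by omega)
          _ = (7 + 6 * (4 * k + 1)) * P.card := by ring
          _ ≤ _ := Nat.mul_le_mul_left _ hPk
    have h2 := hPc.two_mul_card_le
    have h3 : crossing H P T = 3 * P.card := by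
      rw [crossing, Finset.sum_congr rfl fun v hv => (hD v (hPD hv)).2]
      simp [mul_comm]
    have h4 : crossing H P T = crossing H P C + (crossing H P P + crossing H P (D \ P)) := by
      rw [crossing_sdiff_right P hPD, ← crossing_union_right P hCD]
      congr 1
      ext v
      exact ⟨fun h => Finset.mem_union.2 (hTCD v h),
        fun h => (Finset.mem_union.1 h).elim (fun h => hCT h) fun h => hDT h⟩
    omega
  have hsum := Finset.sum_le_sum hmain
  rw [Finset.sum_add_distrib, Finset.sum_add_distrib] at hsum
  have hpair : (Q : Set (Finset V)).PairwiseDisjoint id := fun P hP P' hP' hne =>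
    hQd P hP P' hP' hne
  have e1 : ∑ P ∈ Q, P.card = B.card := (Finset.card_biUnion hpair).symm
  have e2 : ∑ P ∈ Q, crossing H P C = crossing H C B := by
    rw [crossing_comm, crossing, hBdef, Finset.sum_biUnion hpair]
    rfl
  have e3 : (C.filter fun c => degIn H B c = 1).card ≤ ∑ P ∈ Q, (J P).card := by
    refine le_trans (Finset.card_le_card ?_) Finset.card_biUnion_le
    intro c hc
    obtain ⟨hcC, hc1⟩ := Finset.mem_filter.1 hc
    obtain ⟨u, hu, hcu⟩ := exists_of_one_le_degIn hc1.ge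
    obtain ⟨P, hP, huP⟩ := Finset.mem_biUnion.1 hu
    exact Finset.mem_biUnion.2 ⟨P, hP, Finset.mem_filter.2 ⟨hcC, one_le_degIn huP hcu, hc1⟩⟩
  have e4 : 2 * C.card ≤ (C.filter fun c => degIn H B c = 1).card + crossing H C B := by
    rw [Finset.card_filter (fun c => degIn H B c = 1) C, crossing, ← Finset.sum_add_distrib, mul_comm, ← smul_eq_mul]
    refine Finset.card_nsmul_le_sum _ _ _ fun c hc => ?_
    have := hCB c hc
    split_ifs <;> omega
  have e5 := Finset.card_le_card hBD
  have e6 : 2 * C.card ≤ D.card + 2 * Q.card := by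
    have : ∑ P ∈ Q, 2 = 2 * Q.card := by simp [mul_comm]
    omega
  rw [hcut]
  nlinarith

lemma crossing_sdiff_comm (hTW : T ⊆ W) :
    crossing H (W \ T) (W \ (W \ T)) = crossing H T (W \ T) := by
  rw [Finset.sdiff_sdiff_eq_self hTW, crossing_comm]

lemma exists_bisection (hk : 1 ≤ k) (hdeg : ∀ v ∈ W, degIn H W v = 3)
    (hL : (7 + 6 * (4 * k + 1)) * (k + 3 * k * k) ≤ L) :
    ∃ T ⊆ W, 2 * T.card ≤ W.card + 2 * L ∧ 2 * (W \ T).card ≤ W.card + 2 * L ∧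
      6 * k * crossing H T (W \ T) ≤ (k + 2) * (W.card + 2 * L) := by
  have hLpos : 1 ≤ L := by
    refine le_trans ?_ hL
    exact Nat.mul_pos (by omega) (by omega)
  set F := W.powerset.filter fun S => W.card ≤ 2 * S.card + 2 * L ∧ 2 * S.card ≤ W.card + 2 * L
    with hF
  have hmem : ∀ S, S ∈ F ↔ S ⊆ W ∧ W.card ≤ 2 * S.card + 2 * L ∧ 2 * S.card ≤ W.card + 2 * L := by
    intro S
    rw [hF, Finset.mem_filter, Finset.mem_powerset]
  have hne : F.Nonempty := by
    obtain ⟨S, hS, hc⟩ := Finset.exists_subset_card_eq (Nat.div_le_self W.card 2)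
    exact ⟨S, (hmem S).2 ⟨hS, by omega, by omega⟩⟩
  have hcompl : ∀ S ∈ F, W \ S ∈ F := by
    intro S hS
    obtain ⟨h1, h2, h3⟩ := (hmem S).1 hS
    have := Finset.card_sdiff_add_card_eq_card h1
    exact (hmem _).2 ⟨Finset.sdiff_subset, by omega, by omega⟩
  obtain ⟨S, hSF, hmin⟩ := Finset.exists_min_image F (fun S => crossing H S (W \ S)) hne
  obtain ⟨T, hTF, hTmin, hTn⟩ : ∃ T ∈ F,
      (∀ S ∈ F, crossing H T (W \ T) ≤ crossing H S (W \ S)) ∧ W.card ≤ 2 * T.card := by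
    have h1 := (hmem S).1 hSF
    have h2 := Finset.card_sdiff_add_card_eq_card h1.1
    rcases le_total W.card (2 * S.card) with h | h
    · exact ⟨S, hSF, hmin, h⟩
    · refine ⟨W \ S, hcompl S hSF, fun S' hS' => ?_, by omega⟩
      rw [crossing_sdiff_comm h1.1]
      exact hmin S' hS'
  obtain ⟨hTW, hT1, hT2⟩ := (hmem T).1 hTF
  obtain ⟨-, -, hT3⟩ := (hmem _).1 (hcompl T hTF)
  refine ⟨T, hTW, hT2, hT3, ?_⟩
  have key := three_mul_crossing_le hk hdeg hTW hL fun U hU hUL => by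
    have h1 := crossing_sdiff_compl (H := H) hTW hU
    have h2 := Finset.card_sdiff_add_card_eq_card hU
    have h3 := hTmin (T \ U) ((hmem _).2 ⟨Finset.sdiff_subset.trans hTW, by omega, by omega⟩)
    omega
  calc 6 * k * crossing H T (W \ T) = 2 * (3 * k * crossing H T (W \ T)) := by ring
    _ ≤ 2 * ((k + 2) * T.card) := Nat.mul_le_mul_left _ key
    _ = (k + 2) * (2 * T.card) := by ring
    _ ≤ _ := Nat.mul_le_mul_left _ hT2

lemma exists_sweep (hk : 1 ≤ k) (hdeg : ∀ v ∈ W, degIn H W v = 3)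
    (hL : (7 + 6 * (4 * k + 1)) * (k + 3 * k * k) ≤ L) {m : ℕ} :
    ∀ (n : ℕ) (T : Finset V), T.card = n → T ⊆ W → (k + 2) * T.card + 9 * k ≤ 3 * k * m →
      crossing H T (W \ T) ≤ m → ∃ f : V → ℕ, ∀ t, (T.filter fun v => f v = t).card ≤ L ∧
        crossing H (T.filter fun v => t ≤ f v) (W \ T.filter fun v => t ≤ f v) ≤ m := by
  intro n
  induction n using Nat.strong_induction_on with
  | _ n ih =>
    intro T hTn hTW hTm hcut
    rcases T.eq_empty_or_nonempty with rfl | ⟨v, hv⟩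
    · exact ⟨fun _ => 0, fun t => by simp [crossing]⟩
    obtain ⟨U, hUT, hUne, hUL, hUcut⟩ : ∃ U ⊆ T, U.Nonempty ∧ U.card ≤ L ∧
        crossing H (T \ U) (W \ (T \ U)) ≤ m := by
      by_cases hno : ∀ U ⊆ T, U.card ≤ L → crossing H U (W \ T) ≤ crossing H U (T \ U)
      · have h1 := three_mul_crossing_le hk hdeg hTW hL hno
        have h2 := crossing_sdiff_compl (H := H) hTW (Finset.singleton_subset_iff.2 hv)
        have h3 := degIn_mono (H := H) (Finset.sdiff_subset.trans hTW : T \ {v} ⊆ W) v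
        rw [crossing_singleton, crossing_singleton] at h2
        rw [hdeg v (hTW hv)] at h3
        refine ⟨{v}, Finset.singleton_subset_iff.2 hv, Finset.singleton_nonempty v, ?_, ?_⟩
        · rw [Finset.card_singleton]
          exact le_trans (Nat.mul_pos (by omega) (by omega)) hL
        · have h4 : crossing H (T \ {v}) (W \ (T \ {v})) ≤ crossing H T (W \ T) + 3 := by omega
          refine le_of_mul_le_mul_left (a := 3 * k) ?_ (by omega)
          calc 3 * k * crossing H (T \ {v}) (W \ (T \ {v}))
              ≤ 3 * k * (crossing H T (W \ T) + 3) := Nat.mul_le_mul_left _ h4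
            _ = 3 * k * crossing H T (W \ T) + 9 * k := by ring
            _ ≤ _ := (Nat.add_le_add_right h1 _).trans hTm
      · push Not at hno
        obtain ⟨U, hUT, hUL, hU⟩ := hno
        have h2 := crossing_sdiff_compl (H := H) hTW hUT
        refine ⟨U, hUT, ?_, hUL, by omega⟩
        rw [Finset.nonempty_iff_ne_empty]
        rintro rfl
        simp [crossing] at hU
    have hlt : (T \ U).card < T.card := Finset.card_lt_card (Finset.sdiff_ssubset hUT hUne)
    obtain ⟨f, hf⟩ := ih _ (hTn ▸ hlt) (T \ U) rfl (Finset.sdiff_subset.trans hTW)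
      (le_trans (by gcongr) hTm) hUcut
    refine ⟨fun v => if v ∈ U then 0 else f v + 1, fun t => ?_⟩
    cases t with
    | zero =>
      refine ⟨le_trans (Finset.card_le_card fun v hv => ?_) hUL, by simpa using hcut⟩
      by_contra h
      simp [h] at hv
    | succ t =>
      have e1 : (T.filter fun v => (if v ∈ U then 0 else f v + 1) = t + 1) =
          (T \ U).filter fun v => f v = t := by
        ext v
        by_cases h : v ∈ U <;> simp [h]
      have e2 : (T.filter fun v => t + 1 ≤ if v ∈ U then 0 else f v + 1) =
          (T \ U).filter fun v => t ≤ f v := by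
        ext v
        by_cases h : v ∈ U <;> simp [h]
      rw [e1, e2]
      exact hf t

lemma HasLayout.of_crossing {f : V → ℕ} {l m : ℕ}
    (hf : ∀ t, (W.filter fun v => f v = t).card ≤ l ∧
      crossing H (W.filter fun v => t ≤ f v) (W \ W.filter fun v => t ≤ f v) ≤ m) :
    HasLayout H W (l + m : ℕ) := by
  refine ⟨f, fun t => ?_⟩
  obtain ⟨h1, h2⟩ := hf t
  have hsub : bag H W f t ⊆ (W.filter fun v => f v = t) ∪
      (W.filter fun v => t ≤ f v).biUnion (nbrs H (W \ W.filter fun v => t ≤ f v)) := by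
    intro v hv
    obtain ⟨hvW, hv | ⟨hlt, u, hu, hvu, htu⟩⟩ := mem_bag.1 hv
    · exact Finset.mem_union_left _ (Finset.mem_filter.2 ⟨hvW, hv⟩)
    · refine Finset.mem_union_right _ (Finset.mem_biUnion.2 ⟨u, Finset.mem_filter.2 ⟨hu, htu⟩,
        mem_nbrs.2 ⟨Finset.mem_sdiff.2 ⟨hvW, fun h => ?_⟩, hvu.symm⟩⟩)
      have := (Finset.mem_filter.1 h).2
      omega
  have h3 := Finset.card_le_card hsub
  have h4 := Finset.card_union_le (W.filter fun v => f v = t)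
    ((W.filter fun v => t ≤ f v).biUnion (nbrs H (W \ W.filter fun v => t ≤ f v)))
  have h5 : ((W.filter fun v => t ≤ f v).biUnion
      (nbrs H (W \ W.filter fun v => t ≤ f v))).card ≤ m := Finset.card_biUnion_le.trans h2
  exact_mod_cast (by omega : (bag H W f t).card ≤ l + m)

lemma HasLayout.of_sweeps (hTW : T ⊆ W) {f g : V → ℕ} {l m : ℕ}
    (hf : ∀ t, (T.filter fun v => f v = t).card ≤ l ∧
      crossing H (T.filter fun v => t ≤ f v) (W \ T.filter fun v => t ≤ f v) ≤ m)
    (hg : ∀ t, ((W \ T).filter fun v => g v = t).card ≤ l ∧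
      crossing H ((W \ T).filter fun v => t ≤ g v) (W \ (W \ T).filter fun v => t ≤ g v) ≤ m) :
    HasLayout H W (l + m : ℕ) := by
  set N := T.sup f with hN
  have hfN : ∀ v ∈ T, f v ≤ N := fun v hv => Finset.le_sup (f := f) hv
  apply HasLayout.of_crossing (f := fun v => if v ∈ T then N - f v else N + 1 + g v)
  intro t
  rcases Nat.lt_or_ge N t with ht | ht
  · have e1 : (W.filter fun v => (if v ∈ T then N - f v else N + 1 + g v) = t) =
        (W \ T).filter fun v => g v = t - (N + 1) := by
      ext v
      have := hfN v
      by_cases h : v ∈ T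
      · simp only [Finset.mem_filter, Finset.mem_sdiff, if_pos h]
        grind
      · simp only [Finset.mem_filter, Finset.mem_sdiff, if_neg h]
        grind
    have e2 : (W.filter fun v => t ≤ if v ∈ T then N - f v else N + 1 + g v) =
        (W \ T).filter fun v => t - (N + 1) ≤ g v := by
      ext v
      have := hfN v
      by_cases h : v ∈ T
      · simp only [Finset.mem_filter, Finset.mem_sdiff, if_pos h]
        grind
      · simp only [Finset.mem_filter, Finset.mem_sdiff, if_neg h]
        grind
    rw [e1, e2]
    exact hg _
  · have e1 : (W.filter fun v => (if v ∈ T then N - f v else N + 1 + g v) = t) =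
        T.filter fun v => f v = N - t := by
      ext v
      have := hfN v
      have := @hTW v
      by_cases h : v ∈ T
      · simp only [Finset.mem_filter, if_pos h]
        grind
      · simp only [Finset.mem_filter, if_neg h]
        grind
    have e2 : (W.filter fun v => t ≤ if v ∈ T then N - f v else N + 1 + g v) =
        W \ T.filter fun v => N + 1 - t ≤ f v := by
      ext v
      have := hfN v
      have := @hTW v
      by_cases h : v ∈ T
      · simp only [Finset.mem_filter, Finset.mem_sdiff, if_pos h]
        grind
      · simp only [Finset.mem_filter, Finset.mem_sdiff, if_neg h]
        grind
    rw [e1, e2, crossing_sdiff_comm ((Finset.filter_subset _ _).trans hTW)]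
    exact ⟨(hf _).1, (hf _).2⟩

/-- Cubic graphs have pathwidth at most `n / 6 + o(n)`. -/
theorem exists_hasLayout_of_cubic {ε : ℝ} (hε : 0 < ε) :
    ∃ c : ℝ, 0 ≤ c ∧ ∀ (V : Type) (H : SimpleGraph V) (W : Finset V), (∀ v ∈ W, degIn H W v = 3) →
      HasLayout H W (W.card / 6 + ε * W.card + c) := by
  obtain ⟨k, hk⟩ := exists_nat_gt (max 1 (1 / ε))
  have hk1 : (1 : ℝ) < k := (le_max_left _ _).trans_lt hk
  have hkε : 1 < k * ε := (div_lt_iff₀ hε).1 ((le_max_right _ _).trans_lt hk)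
  have hkn : 1 ≤ k := by exact_mod_cast hk1.le
  set L := (7 + 6 * (4 * k + 1)) * (k + 3 * k * k) with hL
  refine ⟨L + (1 / 3 + ε) * L + 4, by positivity, fun V H W hdeg => ?_⟩
  obtain ⟨T, hTW, hT1, hT2, hcut⟩ := exists_bisection hkn hdeg hL.ge
  set x : ℝ := (1 / 3 + ε) * (W.card / 2 + L) with hx
  have hx0 : 0 ≤ x := by positivity
  set m := ⌈x⌉₊ + 3 with hm
  have hm1 : x + 3 ≤ m := by
    rw [hm]
    push_cast
    linarith [Nat.le_ceil x]
  have hm2 : (m : ℝ) ≤ x + 4 := by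
    rw [hm]
    push_cast
    linarith [Nat.ceil_lt_add_one hx0]
  have hkx : (k + 2 : ℝ) * (W.card + 2 * L) ≤ 6 * k * x := by
    have : 6 * k * x = (k + 3 * (k * ε)) * ((W.card : ℝ) + 2 * L) := by rw [hx]; ring
    rw [this]
    gcongr
    linarith
  have hbound : ∀ S : Finset V, 2 * S.card ≤ W.card + 2 * L →
      (k + 2) * S.card + 9 * k ≤ 3 * k * m := by
    intro S hS
    have h1 : (2 : ℝ) * S.card ≤ W.card + 2 * L := by exact_mod_cast hS
    have h2 : ((k + 2) * S.card + 9 * k : ℝ) ≤ 3 * k * m := by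
      have h3 := mul_le_mul_of_nonneg_left h1 (by positivity : (0 : ℝ) ≤ k + 2)
      have h4 := mul_le_mul_of_nonneg_left hm1 (by positivity : (0 : ℝ) ≤ 3 * k)
      linarith
    exact_mod_cast h2
  have hcutm : crossing H T (W \ T) ≤ m := by
    have h1 : (6 * k * crossing H T (W \ T) : ℝ) ≤ (k + 2) * (W.card + 2 * L) := by
      exact_mod_cast hcut
    have h2 : (crossing H T (W \ T) : ℝ) ≤ x :=
      le_of_mul_le_mul_left (h1.trans hkx) (by positivity)
    exact_mod_cast (by linarith : (crossing H T (W \ T) : ℝ) ≤ m)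
  obtain ⟨f, hf⟩ := exists_sweep hkn hdeg hL.ge _ T rfl hTW (hbound T hT1) hcutm
  obtain ⟨g, hg⟩ := exists_sweep hkn hdeg hL.ge _ (W \ T) rfl Finset.sdiff_subset
    (hbound _ hT2) (by rwa [crossing_sdiff_comm hTW])
  refine (HasLayout.of_sweeps hTW hf hg).mono ?_
  push_cast
  have : (0 : ℝ) ≤ ε * W.card := by positivity
  rw [hx] at hm2
  linarith

end Cubic

section Weights

variable {W M : Finset V}

/-- The weight of a vertex of degree `d` in the potential function. -/
def weight : ℕ → ℕ
  | 0 => 0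
  | 1 => 0
  | 2 => 0
  | 3 => 45
  | 4 => 90
  | 5 => 117
  | 6 => 138
  | 7 => 162
  | d + 8 => 23 * (d + 8)

lemma weight_mono : Monotone weight := by
  refine monotone_nat_of_le_succ fun d => ?_
  rcases lt_or_ge d 8 with h | h
  · interval_cases d <;> simp [weight]
  · obtain ⟨d, rfl⟩ := Nat.exists_eq_add_of_le' h
    simp only [weight]
    omega

lemma weight_add_le {a b : ℕ} (hab : a < b) (hb : 3 ≤ b) : weight a + 21 ≤ weight b := by
  refine le_trans (Nat.add_le_add_right (weight_mono (Nat.le_sub_one_of_lt hab)) 21) ?_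
  rcases lt_or_ge b 9 with h | h
  · interval_cases b <;> simp [weight]
  · obtain ⟨b, rfl⟩ := Nat.exists_eq_add_of_le' h
    simp only [weight, show b + 9 - 1 = b + 8 by omega,
      show b + 9 = (b + 1) + 8 by omega]
    omega

lemma weight_add_le_of_eq_six {a b : ℕ} (hab : a < b) (hb : 3 ≤ b) (ha : 3 ≤ a → a = 6) :
    weight a + 24 ≤ weight b := by
  by_cases h : 3 ≤ a
  · rw [ha h]
    exact weight_mono (by have := ha h; omega : 7 ≤ b)
  · have h1 : weight a ≤ 0 := weight_mono (by omega : a ≤ 2)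
    have h2 : 45 ≤ weight b := weight_mono hb
    omega

lemma weight_le {d D : ℕ} (hD : Even D) (hd : d ≤ D) : weight d ≤ 23 * D := by
  refine (weight_mono hd).trans ?_
  rcases lt_or_ge D 8 with h | h
  · interval_cases D <;> first | exact absurd hD (by decide) | simp [weight]
  · obtain ⟨d, rfl⟩ := Nat.exists_eq_add_of_le' h
    simp only [weight]
    omega

/-- The potential of the graph induced on `W`. -/
noncomputable def potential (H : SimpleGraph V) (W : Finset V) : ℕ :=
  ∑ v ∈ W, weight (degIn H W v)

/-- All vertices of degree at least three have degree `d`, and there is such a vertex. -/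
def IsNearlyRegular (H : SimpleGraph V) (W : Finset V) (d : ℕ) : Prop :=
  (∃ v ∈ W, degIn H W v = d) ∧ ∀ v ∈ W, 3 ≤ degIn H W v → degIn H W v = d

/-- The correction of the potential for graphs all of whose vertices of degree at least three
have degree six, or all have degree five. -/
noncomputable def bonus (H : SimpleGraph V) (W : Finset V) : ℕ :=
  if IsNearlyRegular H W 6 then 24 else if IsNearlyRegular H W 5 then 18 else 0

lemma bonus_le (H : SimpleGraph V) (W : Finset V) : bonus H W ≤ 24 := by
  unfold bonus
  split_ifs <;> omega

lemma bonus_eq_zero (h : ∀ v ∈ W, degIn H W v ≤ 4) : bonus H W = 0 := by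
  unfold bonus
  rw [if_neg, if_neg]
  all_goals
    rintro ⟨⟨v, hv, hd⟩, -⟩
    have := h v hv
    omega

lemma bonus_ne_zero (h : bonus H W ≠ 0) :
    IsNearlyRegular H W 6 ∨ bonus H W = 18 ∧ IsNearlyRegular H W 5 := by
  unfold bonus at h ⊢
  split_ifs at h ⊢ with h1 h2 <;> tauto

lemma potential_mono (h : M ⊆ W) : potential H M ≤ potential H W :=
  (Finset.sum_le_sum fun v _ => weight_mono (degIn_mono h v)).trans
    (Finset.sum_le_sum_of_subset h)

/-- The decrease of the potential at the vertex `u` on passing from `W` to `M`. -/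
noncomputable def loss (H : SimpleGraph V) (W M : Finset V) (u : V) : ℕ :=
  weight (degIn H W u) - if u ∈ M then weight (degIn H M u) else 0

lemma loss_add (h : M ⊆ W) (u : V) :
    loss H W M u + (if u ∈ M then weight (degIn H M u) else 0) = weight (degIn H W u) := by
  refine Nat.sub_add_cancel ?_
  split_ifs
  · exact weight_mono (degIn_mono h u)
  · exact Nat.zero_le _

lemma potential_add_loss_le {v : V} (hv : v ∈ W) (hM : M ⊆ W.erase v) :
    potential H M + weight (degIn H W v) + ∑ u ∈ nbrs H W v, loss H W M u ≤ potential H W := by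
  have h1 : nbrs H W v ⊆ W.erase v := fun u hu =>
    Finset.mem_erase.2 ⟨(mem_nbrs.1 hu).2.ne', (mem_nbrs.1 hu).1⟩
  have h2 : potential H W = weight (degIn H W v) + ∑ u ∈ W.erase v, weight (degIn H W u) :=
    (Finset.add_sum_erase W _ hv).symm
  have h3 : ∑ u ∈ W.erase v, weight (degIn H W u) =
      ∑ u ∈ W.erase v, loss H W M u + potential H M := by
    rw [potential, ← Finset.inter_eq_right.2 hM, ← Finset.sum_ite_mem, ← Finset.sum_add_distrib,
      Finset.inter_eq_right.2 hM]
    exact Finset.sum_congr rfl fun u _ => (loss_add (hM.trans (Finset.erase_subset v W)) u).symm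
  have h4 := Finset.sum_le_sum_of_subset (f := loss H W M) h1
  omega

lemma degIn_add_one {v : V} (hv : v ∈ W) (hM : M ⊆ W.erase v)
    (hcl : IsClosedIn H (W.erase v) M) {u : V} (hu : u ∈ nbrs H W v) (huM : u ∈ M) :
    degIn H M u + 1 = degIn H W u := by
  have hvu := (mem_nbrs.1 hu).2
  have : nbrs H W u = insert v (nbrs H M u) := by
    ext w
    rw [Finset.mem_insert, mem_nbrs, mem_nbrs]
    constructor
    · rintro ⟨hw, huw⟩
      by_cases hwv : w = v
      · exact Or.inl hwv
      · refine Or.inr ⟨?_, huw⟩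
        by_contra hwM
        exact hcl u huM w (Finset.mem_erase.2 ⟨hwv, hw⟩) hwM huw
    · rintro (rfl | ⟨hw, huw⟩)
      · exact ⟨hv, hvu.symm⟩
      · exact ⟨Finset.mem_of_mem_erase (hM hw), huw⟩
  unfold degIn
  rw [this, Finset.card_insert_of_notMem]
  rw [mem_nbrs]
  exact fun h => (Finset.mem_erase.1 (hM h.1)).1 rfl

lemma loss_cases {v : V} (hv : v ∈ W) (hM : M ⊆ W.erase v)
    (hcl : IsClosedIn H (W.erase v) M) {u : V} (hu : u ∈ nbrs H W v) :
    u ∉ M ∧ loss H W M u = weight (degIn H W u) ∨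
      u ∈ M ∧ degIn H M u + 1 = degIn H W u ∧
        loss H W M u = weight (degIn H W u) - weight (degIn H W u - 1) := by
  by_cases h : u ∈ M
  · have := degIn_add_one hv hM hcl hu h
    refine Or.inr ⟨h, this, ?_⟩
    rw [loss, if_pos h, ← this, Nat.add_sub_cancel]
  · exact Or.inl ⟨h, by rw [loss, if_neg h, Nat.sub_zero]⟩

lemma le_loss {v : V} (hv : v ∈ W) (hM : M ⊆ W.erase v)
    (hcl : IsClosedIn H (W.erase v) M) {u : V} (hu : u ∈ nbrs H W v)
    (h3 : 3 ≤ degIn H W u) :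
    21 ≤ loss H W M u ∧ (degIn H W u ≤ 5 → 27 ≤ loss H W M u) ∧
      (degIn H W u ≤ 4 → 45 ≤ loss H W M u) := by
  have h45 : 45 ≤ weight (degIn H W u) := weight_mono h3
  rcases loss_cases hv hM hcl hu with ⟨-, h⟩ | ⟨-, -, h⟩
  · omega
  · have h21 := weight_add_le (a := degIn H W u - 1) (b := degIn H W u) (by omega) h3
    rw [h]
    refine ⟨by omega, fun h5 => ?_, fun h4 => ?_⟩
    · generalize degIn H W u = d at *
      interval_cases d <;> simp [weight]
    · generalize degIn H W u = d at *
      interval_cases d <;> simp [weight]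

lemma le_loss_of_isNearlyRegular {v : V} (hv : v ∈ W) (hM : M ⊆ W.erase v)
    (hcl : IsClosedIn H (W.erase v) M) {u : V} (hu : u ∈ nbrs H W v) {d : ℕ}
    (h3 : 3 ≤ degIn H W u) (hd : degIn H W u ≤ d) (hreg : IsNearlyRegular H M d) :
    45 ≤ loss H W M u := by
  have h45 : 45 ≤ weight (degIn H W u) := weight_mono h3
  rcases loss_cases hv hM hcl hu with ⟨-, h⟩ | ⟨huM, h1, h⟩
  · omega
  · have h2 := hreg.2 u huM
    have h3 : degIn H W u = 3 := by omega
    rw [h, h3]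
    simp [weight]

lemma mul_add_le_sum_loss {v u : V} (hu : u ∈ nbrs H W v) {a b : ℕ}
    (h : ∀ u ∈ nbrs H W v, a ≤ loss H W M u) (hb : b ≤ loss H W M u) :
    (degIn H W v - 1) * a + b ≤ ∑ u ∈ nbrs H W v, loss H W M u := by
  rw [← Finset.sum_erase_add _ _ hu]
  refine Nat.add_le_add ?_ hb
  rw [degIn, ← Finset.card_erase_of_mem hu, ← smul_eq_mul]
  exact Finset.card_nsmul_le_sum _ _ _ fun u' hu' => h u' (Finset.mem_of_mem_erase hu')

lemma mul_le_sum_loss {v : V} {a : ℕ} (h : ∀ u ∈ nbrs H W v, a ≤ loss H W M u) :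
    degIn H W v * a ≤ ∑ u ∈ nbrs H W v, loss H W M u :=
  Finset.card_nsmul_le_sum _ _ _ h

/-- In a connected graph of minimum degree at least three which is not cubic there is a vertex
whose deletion decreases the potential considerably. -/
lemma exists_deletion (hW : IsConn H W) (h3 : ∀ v ∈ W, 3 ≤ degIn H W v)
    (hcubic : ¬ ∀ v ∈ W, degIn H W v = 3) :
    ∃ v ∈ W, ∀ M ⊆ W.erase v, IsClosedIn H (W.erase v) M →
      potential H M + bonus H M + 270 ≤ potential H W + bonus H W := by
  have hne : W.Nonempty := by
    by_contra h
    rw [Finset.not_nonempty_iff_eq_empty] at h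
    simp [h] at hcubic
  have hreg : ∀ d, (∀ v ∈ W, degIn H W v ≤ d) → (∃ v ∈ W, degIn H W v = d) →
      (∃ v ∈ W, degIn H W v = d ∧ ∃ u ∈ nbrs H W v, degIn H W u < d) ∨
        ∀ v ∈ W, degIn H W v = d := by
    intro d hd ⟨v, hv, hvd⟩
    by_cases h : ∃ v ∈ W, degIn H W v = d ∧ ∃ u ∈ nbrs H W v, degIn H W u < d
    · exact Or.inl h
    · right
      have := hW (W.filter fun v => degIn H W v = d) (Finset.filter_subset _ _)
        ⟨v, Finset.mem_filter.2 ⟨hv, hvd⟩⟩ fun u hu w hw hwM huw => by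
          obtain ⟨huW, hud⟩ := Finset.mem_filter.1 hu
          refine h ⟨u, huW, hud, w, mem_nbrs.2 ⟨hw, huw⟩, (hd w hw).lt_of_ne fun h => ?_⟩
          exact hwM (Finset.mem_filter.2 ⟨hw, h⟩)
      exact Finset.filter_eq_self.1 this
  obtain ⟨x, hx, hmax⟩ := Finset.exists_max_image W (degIn H W) hne
  have hx3 := h3 x hx
  have hx4 : degIn H W x ≠ 3 := fun h => hcubic fun v hv => by
    have := hmax v hv
    have := h3 v hv
    omega
  have hnb : ∀ {v u}, u ∈ nbrs H W v → 3 ≤ degIn H W u ∧ degIn H W u ≤ degIn H W x :=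
    fun hu => ⟨h3 _ (mem_nbrs.1 hu).1, hmax _ (mem_nbrs.1 hu).1⟩
  rcases lt_or_ge 6 (degIn H W x) with hx7 | hx6
  · refine ⟨x, hx, fun M hM hcl => ?_⟩
    have e1 := potential_add_loss_le (H := H) hx hM
    have e2 := mul_le_sum_loss fun u hu => (le_loss hx hM hcl hu (hnb hu).1).1
    have e3 : 162 ≤ weight (degIn H W x) := weight_mono hx7
    have e4 := bonus_le H M
    omega
  obtain h4 | h5 | h6 : degIn H W x = 4 ∨ degIn H W x = 5 ∨ degIn H W x = 6 := by omega
  · refine ⟨x, hx, fun M hM hcl => ?_⟩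
    have e1 := potential_add_loss_le (H := H) hx hM
    have e2 := mul_le_sum_loss fun u hu =>
      (le_loss hx hM hcl hu (hnb hu).1).2.2 (h4 ▸ (hnb hu).2)
    have e3 : bonus H M = 0 := bonus_eq_zero fun v hv =>
      (degIn_mono (hM.trans (Finset.erase_subset _ _)) v).trans
        (h4 ▸ hmax v (Finset.mem_of_mem_erase (hM hv)))
    rw [h4] at e1 e2
    simp only [weight] at e1
    omega
  · have hbonus : ∀ v ∈ W, degIn H W v = 5 → ∀ M ⊆ W.erase v, IsClosedIn H (W.erase v) M →
        bonus H M = 0 ∨ potential H M + bonus H M + 270 ≤ potential H W := by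
      intro v hv hvd M hM hcl
      by_cases h0 : bonus H M = 0
      · exact Or.inl h0
      · right
        rcases bonus_ne_zero h0 with ⟨⟨u, hu, hud⟩, -⟩ | ⟨h18, hr⟩
        · have := degIn_mono (H := H) (hM.trans (Finset.erase_subset _ _)) u
          have := hmax u (Finset.mem_of_mem_erase (hM hu))
          omega
        · have e1 := potential_add_loss_le (H := H) hv hM
          have e2 := mul_le_sum_loss fun u hu =>
            le_loss_of_isNearlyRegular hv hM hcl hu (hnb hu).1 (h5 ▸ (hnb hu).2) hr
          rw [hvd] at e1 e2
          simp only [weight] at e1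
          omega
    rcases hreg 5 (fun v hv => h5 ▸ hmax v hv) ⟨x, hx, h5⟩ with ⟨v, hv, hvd, u, hu, hud⟩ | hall
    · refine ⟨v, hv, fun M hM hcl => ?_⟩
      rcases hbonus v hv hvd M hM hcl with h0 | h0
      · have e1 := potential_add_loss_le (H := H) hv hM
        have e2 := mul_add_le_sum_loss hu (fun u hu =>
          (le_loss hv hM hcl hu (hnb hu).1).2.1 (h5 ▸ (hnb hu).2))
          ((le_loss hv hM hcl hu (hnb hu).1).2.2 (by omega))
        rw [hvd] at e1 e2
        simp only [weight] at e1
        omega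
      · omega
    · refine ⟨x, hx, fun M hM hcl => ?_⟩
      rcases hbonus x hx h5 M hM hcl with h0 | h0
      · have e1 := potential_add_loss_le (H := H) hx hM
        have e2 := mul_le_sum_loss fun u hu =>
          (le_loss hx hM hcl hu (hnb hu).1).2.1 (h5 ▸ (hnb hu).2)
        have e3 : bonus H W = 18 := by
          unfold bonus
          rw [if_neg, if_pos ⟨⟨x, hx, h5⟩, fun v hv _ => hall v hv⟩]
          rintro ⟨⟨v, hv, hvd⟩, -⟩
          have := hall v hv
          omega
        rw [h5] at e1 e2
        simp only [weight] at e1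
        omega
      · omega
  · have hbonus : ∀ v ∈ W, degIn H W v = 6 → ∀ M ⊆ W.erase v, IsClosedIn H (W.erase v) M →
        bonus H M = 0 ∨ bonus H M = 18 ∧ IsNearlyRegular H M 5 ∨
          potential H M + bonus H M + 270 ≤ potential H W := by
      intro v hv hvd M hM hcl
      by_cases h0 : bonus H M = 0
      · exact Or.inl h0
      · right
        rcases bonus_ne_zero h0 with hr | h18
        · right
          have e1 := potential_add_loss_le (H := H) hv hM
          have e2 := mul_le_sum_loss fun u hu =>
            le_loss_of_isNearlyRegular hv hM hcl hu (hnb hu).1 (h6 ▸ (hnb hu).2) hr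
          have e3 := bonus_le H M
          rw [hvd] at e1 e2
          simp only [weight] at e1
          omega
        · exact Or.inl h18
    rcases hreg 6 (fun v hv => h6 ▸ hmax v hv) ⟨x, hx, h6⟩ with ⟨v, hv, hvd, u, hu, hud⟩ | hall
    · refine ⟨v, hv, fun M hM hcl => ?_⟩
      have e1 := potential_add_loss_le (H := H) hv hM
      have e2 : ∀ b ≤ loss H W M u, _ := fun b => mul_add_le_sum_loss hu fun u hu =>
        (le_loss hv hM hcl hu (hnb hu).1).1
      rw [hvd] at e1 e2
      simp only [weight] at e1
      rcases hbonus v hv hvd M hM hcl with h0 | ⟨h18, hr⟩ | h0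
      · have := e2 27 ((le_loss hv hM hcl hu (hnb hu).1).2.1 (by omega))
        omega
      · have := e2 45 (le_loss_of_isNearlyRegular hv hM hcl hu (hnb hu).1 (by omega) hr)
        omega
      · omega
    · refine ⟨x, hx, fun M hM hcl => ?_⟩
      have e1 := potential_add_loss_le (H := H) hx hM
      have e2 := mul_le_sum_loss fun u hu => (le_loss hx hM hcl hu (hnb hu).1).1
      have e3 : bonus H W = 24 := if_pos ⟨⟨x, hx, h6⟩, fun v hv _ => hall v hv⟩
      rw [h6] at e1 e2
      simp only [weight] at e1
      rcases hbonus x hx h6 M hM hcl with h0 | h0 | h0 <;> omega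

end Weights

section Suppression

variable {G : SimpleGraph V} {k : ℕ} {A W : Finset V} {π : V → V} {v : V}

/-- The graph obtained from `H` by turning the neighbourhood of `v` into a clique. -/
def fill (H : SimpleGraph V) (v : V) : SimpleGraph V where
  Adj a b := H.Adj a b ∨ a ≠ b ∧ H.Adj v a ∧ H.Adj v b
  symm := ⟨fun _ _ h => h.imp SimpleGraph.Adj.symm fun h => ⟨h.1.symm, h.2.2, h.2.1⟩⟩
  loopless := ⟨fun _ h => h.elim (fun h => h.ne rfl) fun h => h.1 rfl⟩

lemma degIn_fill_le (hv : v ∈ W) (hd : degIn H W v ≤ 2) {u : V} (hu : u ∈ W) :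
    degIn (fill H v) (W.erase v) u ≤ degIn H W u := by
  by_cases huv : H.Adj v u
  · have hsub : nbrs (fill H v) (W.erase v) u ⊆ (nbrs H W u).erase v ∪ (nbrs H W v).erase u := by
      intro w hw
      obtain ⟨hw, huw⟩ := mem_nbrs.1 hw
      obtain ⟨hwv, hwW⟩ := Finset.mem_erase.1 hw
      rcases huw with h | ⟨h1, -, h2⟩
      · exact Finset.mem_union_left _ (Finset.mem_erase.2 ⟨hwv, mem_nbrs.2 ⟨hwW, h⟩⟩)
      · exact Finset.mem_union_right _ (Finset.mem_erase.2 ⟨h1.symm, mem_nbrs.2 ⟨hwW, h2⟩⟩)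
    have h1 := (Finset.card_le_card hsub).trans (Finset.card_union_le _ _)
    have h2 := Finset.card_erase_add_one (mem_nbrs.2 ⟨hv, huv.symm⟩ : v ∈ nbrs H W u)
    have h3 := Finset.card_erase_add_one (mem_nbrs.2 ⟨hu, huv⟩ : u ∈ nbrs H W v)
    unfold degIn at *
    omega
  · refine Finset.card_le_card fun w hw => ?_
    obtain ⟨hw, huw⟩ := mem_nbrs.1 hw
    exact mem_nbrs.2 ⟨Finset.mem_of_mem_erase hw, huw.resolve_right fun h => huv h.2.1⟩

lemma potential_fill_le (hv : v ∈ W) (hd : degIn H W v ≤ 2) :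
    potential (fill H v) (W.erase v) + bonus (fill H v) (W.erase v) ≤
      potential H W + bonus H W := by
  have hle : ∀ u ∈ W.erase v, weight (degIn (fill H v) (W.erase v) u) ≤ weight (degIn H W u) :=
    fun u hu => weight_mono (degIn_fill_le hv hd (Finset.mem_of_mem_erase hu))
  have hpot : potential (fill H v) (W.erase v) ≤ potential H W :=
    (Finset.sum_le_sum hle).trans (Finset.sum_le_sum_of_subset (Finset.erase_subset v W))
  by_cases heq : ∀ u ∈ W.erase v, 3 ≤ degIn H W u →
      degIn (fill H v) (W.erase v) u = degIn H W u
  · have hreg : ∀ d, 3 ≤ d →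
        (IsNearlyRegular (fill H v) (W.erase v) d ↔ IsNearlyRegular H W d) := by
      intro d hd3
      have hmem : ∀ u ∈ W, 3 ≤ degIn H W u → u ∈ W.erase v := by
        intro u hu h
        refine Finset.mem_erase.2 ⟨?_, hu⟩
        rintro rfl
        omega
      have hge : ∀ u ∈ W.erase v, 3 ≤ degIn (fill H v) (W.erase v) u →
          3 ≤ degIn H W u := fun u hu h =>
        h.trans (degIn_fill_le hv hd (Finset.mem_of_mem_erase hu))
      constructor
      · rintro ⟨⟨u, hu, hud⟩, h⟩
        refine ⟨⟨u, Finset.mem_of_mem_erase hu, ?_⟩, fun u hu h3 => ?_⟩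
        · rw [← heq u hu (hge u hu (by omega)), hud]
        · have hu' := hmem u hu h3
          rw [← heq u hu' h3]
          exact h u hu' (by rwa [heq u hu' h3])
      · rintro ⟨⟨u, hu, hud⟩, h⟩
        refine ⟨⟨u, hmem u hu (by omega), ?_⟩, fun u hu h3 => ?_⟩
        · rw [heq u (hmem u hu (by omega)) (by omega), hud]
        · have h3' := hge u hu h3
          rw [heq u hu h3']
          exact h u (Finset.mem_of_mem_erase hu) h3'
    have hbonus : bonus (fill H v) (W.erase v) = bonus H W := by
      unfold bonus
      simp only [hreg 6 (by norm_num), hreg 5 (by norm_num)]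
    omega
  · push Not at heq
    obtain ⟨x, hx, hx3, hxd⟩ := heq
    have hlt := (degIn_fill_le hv hd (Finset.mem_of_mem_erase hx)).lt_of_ne hxd
    have hdrop : ∀ c, weight (degIn (fill H v) (W.erase v) x) + c ≤ weight (degIn H W x) →
        potential (fill H v) (W.erase v) + c ≤ potential H W := by
      intro c hc
      have h1 : ∑ u ∈ (W.erase v).erase x, weight (degIn (fill H v) (W.erase v) u) ≤
          ∑ u ∈ (W.erase v).erase x, weight (degIn H W u) :=
        Finset.sum_le_sum fun u hu => hle u (Finset.mem_of_mem_erase hu)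
      have h2 := Finset.add_sum_erase (W.erase v)
        (fun u => weight (degIn (fill H v) (W.erase v) u)) hx
      have h3 := Finset.add_sum_erase (W.erase v) (fun u => weight (degIn H W u)) hx
      have h4 : ∑ u ∈ W.erase v, weight (degIn H W u) ≤ potential H W :=
        Finset.sum_le_sum_of_subset (Finset.erase_subset v W)
      unfold potential at *
      omega
    by_cases h0 : bonus (fill H v) (W.erase v) = 0
    · omega
    rcases bonus_ne_zero h0 with h6 | ⟨h18, -⟩
    · have h1 := hdrop 24 (weight_add_le_of_eq_six hlt hx3 (h6.2 x hx))
      have h2 := bonus_le (fill H v) (W.erase v)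
      omega
    · have h1 := hdrop 21 (weight_add_le hlt hx3)
      omega

lemma IsConn.fill (hW : IsConn H W) (hv : v ∈ W) : IsConn (fill H v) (W.erase v) := by
  intro M hM hne hcl
  have hvM : v ∉ M := fun h => (Finset.mem_erase.1 (hM h)).1 rfl
  by_cases hnb : ∃ a ∈ M, H.Adj v a
  · obtain ⟨a, ha, hva⟩ := hnb
    have hins : insert v M = W := by
      refine hW _ ?_ (Finset.insert_nonempty v M) ?_
      · exact Finset.insert_subset hv (hM.trans (Finset.erase_subset v W))
      · intro u hu w hw hwM huw
        rw [Finset.mem_insert, not_or] at hwM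
        have hw' : w ∈ W.erase v := Finset.mem_erase.2 ⟨hwM.1, hw⟩
        rcases Finset.mem_insert.1 hu with rfl | hu
        · refine hcl a ha w hw' hwM.2 (Or.inr ⟨?_, hva, huw⟩)
          rintro rfl
          exact hwM.2 ha
        · exact hcl u hu w hw' hwM.2 (Or.inl huw)
    rw [← hins, Finset.erase_insert hvM]
  · push Not at hnb
    have : M = W := by
      refine hW M (hM.trans (Finset.erase_subset v W)) hne ?_
      intro u hu w hw hwM huw
      by_cases hwv : w = v
      · subst hwv
        exact hnb u hu huw.symm
      · exact hcl u hu w (Finset.mem_erase.2 ⟨hwv, hw⟩) hwM (Or.inl huw)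
    exact absurd (this ▸ hv) hvM

/-- The vertices in the pieces attached to `v`. -/
noncomputable def attached (G : SimpleGraph V) (A W : Finset V) (π : V → V) (v : V) : Finset V :=
  (A \ W).filter fun u => ∃ u' ∈ A \ W, π u' = π u ∧ G.Adj u' v

lemma mem_attached {u : V} : u ∈ attached G A W π v ↔
    u ∈ A \ W ∧ ∃ u' ∈ A \ W, π u' = π u ∧ G.Adj u' v := Finset.mem_filter

lemma Overlay.fill (h : Overlay G H k A W π) (hv : v ∈ W)
    (hQ : (attached G A W π v).card + 1 ≤ k) :
    Overlay G (fill H v) k A (W.erase v)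
      (fun u => if u = v ∨ u ∈ attached G A W π v then v else π u) := by
  set Q := attached G A W π v with hQdef
  have hmem : ∀ u, u ∈ A \ W.erase v ↔ u = v ∨ u ∈ A \ W := by
    intro u
    have := h.sub hv
    by_cases huv : u = v
    · subst huv
      simp [this]
    · simp [huv]
  have hlab : ∀ u ∈ A \ W, π u ≠ v := fun u hu e => h.label u hu (e ▸ hv)
  have hQnb : ∀ u ∈ A \ W, G.Adj u v → u ∈ Q := fun u hu huv =>
    mem_attached.2 ⟨hu, u, hu, rfl, huv⟩
  have hQπ : ∀ u ∈ A \ W, ∀ w ∈ A \ W, π u = π w → (u ∈ Q ↔ w ∈ Q) := by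
    intro u hu w hw e
    rw [hQdef, mem_attached, mem_attached, e]
    tauto
  have hadj : ∀ u, u ∈ A \ W.erase v → (u = v ∨ u ∈ Q) → ∀ a ∈ W.erase v, G.Adj u a →
      H.Adj v a := by
    intro u _ huQ a ha hua
    obtain ⟨hav, haW⟩ := Finset.mem_erase.1 ha
    rcases huQ with rfl | huQ
    · exact h.adj_core u hv a haW hua
    · obtain ⟨huA, u', hu', e, hu'v⟩ := mem_attached.1 huQ
      exact (h.clique u huA u' hu' e.symm a haW v hv hua hu'v hav).symm
  refine
    { sub := (Finset.erase_subset v W).trans h.sub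
      adj_core := fun a ha b hb hab =>
        Or.inl (h.adj_core a (Finset.mem_of_mem_erase ha) b (Finset.mem_of_mem_erase hb) hab)
      adj_piece := ?_
      clique := ?_
      size := ?_
      label := ?_ }
  · intro u hu w hw huw
    rw [hmem] at hu hw
    rcases hu with rfl | hu <;> rcases hw with rfl | hw
    · rfl
    · simp [hQnb w hw huw.symm]
    · simp [hQnb u hu huw]
    · have e := h.adj_piece u hu w hw huw
      have hne : u ≠ v := fun e => (Finset.mem_sdiff.1 hu).2 (e ▸ hv)
      have hne' : w ≠ v := fun e => (Finset.mem_sdiff.1 hw).2 (e ▸ hv)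
      simp only [hne, hne', hQπ u hu w hw e, e]
  · intro u hu w hw e a ha b hb hua hwb hab
    by_cases hu' : u = v ∨ u ∈ Q <;> by_cases hw' : w = v ∨ w ∈ Q
    · exact Or.inr ⟨hab, hadj u hu hu' a ha hua, hadj w hw hw' b hb hwb⟩
    · rw [if_pos hu', if_neg hw'] at e
      exact absurd e.symm (hlab w (((hmem w).1 hw).resolve_left fun h => hw' (Or.inl h)))
    · rw [if_neg hu', if_pos hw'] at e
      exact absurd e (hlab u (((hmem u).1 hu).resolve_left fun h => hu' (Or.inl h)))
    · rw [if_neg hu', if_neg hw'] at e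
      exact Or.inl (h.clique u (((hmem u).1 hu).resolve_left fun h => hu' (Or.inl h)) w
        (((hmem w).1 hw).resolve_left fun h => hw' (Or.inl h)) e a (Finset.mem_of_mem_erase ha) b
        (Finset.mem_of_mem_erase hb) hua hwb hab)
  · intro x
    by_cases hxv : x = v
    · refine le_trans (Finset.card_le_card (t := insert v Q) fun u hu => ?_)
        ((Finset.card_insert_le v Q).trans hQ)
      obtain ⟨hu, hux⟩ := Finset.mem_filter.1 hu
      by_contra hcon
      have hu' : ¬ (u = v ∨ u ∈ Q) := by rwa [Finset.mem_insert] at hcon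
      rw [if_neg hu', hxv] at hux
      exact hlab u (((hmem u).1 hu).resolve_left fun h => hu' (Or.inl h)) hux
    · refine le_trans (Finset.card_le_card fun u hu => ?_) (h.size x)
      obtain ⟨hu, hux⟩ := Finset.mem_filter.1 hu
      by_cases hu' : u = v ∨ u ∈ Q
      · rw [if_pos hu'] at hux
        exact absurd hux.symm hxv
      · rw [if_neg hu'] at hux
        exact Finset.mem_filter.2
          ⟨((hmem u).1 hu).resolve_left fun h => hu' (Or.inl h), hux⟩
  · intro u hu
    split_ifs with hu'
    · exact Finset.notMem_erase v W
    · exact fun hmemW => h.label u (((hmem u).1 hu).resolve_left fun h => hu' (Or.inl h))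
        (Finset.mem_of_mem_erase hmemW)

end Suppression

section Induction

variable {G : SimpleGraph V} {k : ℕ} {A W : Finset V} {π : V → V} {v : V} {ε c : ℝ}

/-- The bound for connected cores with fewer than `n` vertices. -/
def LayoutBound (G : SimpleGraph V) (k : ℕ) (ε c : ℝ) (n : ℕ) : Prop :=
  ∀ (H : SimpleGraph V) (A W : Finset V) (π : V → V), W.card < n → Overlay G H k A W π →
    IsConn H W → HasLayout G A ((potential H W + bonus H W : ℕ) / 270 + ε * A.card + c)

lemma LayoutBound.of_parts {n : ℕ} (hB : LayoutBound G k ε c n) (hkc : (k : ℝ) ≤ c)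
    (hε : 0 ≤ ε) (hO : Overlay G H k A W π) (hn : W.card < n) {p : ℕ}
    (hp : ∀ M ⊆ W, IsClosedIn H W M → potential H M + bonus H M ≤ p) :
    HasLayout G A (p / 270 + ε * A.card + c) := by
  refine Overlay.layout_of_components ?_ _ rfl hO fun M hM _ hcl hconn B hBA hOB => ?_
  · have : (0 : ℝ) ≤ p / 270 + ε * A.card := by positivity
    linarith
  · refine (hB H B M π ((Finset.card_le_card hM).trans_lt hn) hOB hconn).mono ?_
    have h1 : ((potential H M + bonus H M : ℕ) : ℝ) ≤ p := by exact_mod_cast hp M hM hcl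
    have h2 : (B.card : ℝ) ≤ A.card := by exact_mod_cast Finset.card_le_card hBA
    have h3 := mul_le_mul_of_nonneg_left h2 hε
    linarith

lemma LayoutBound.deletion (hB : LayoutBound G k ε c W.card) (hkc : (k : ℝ) ≤ c)
    (hε : 0 ≤ ε) (hO : Overlay G H k A W π) (hv : v ∈ W)
    (hp : ∀ M ⊆ W.erase v, IsClosedIn H (W.erase v) M →
      potential H M + bonus H M + 270 ≤ potential H W + bonus H W) :
    HasLayout G A ((potential H W + bonus H W : ℕ) / 270 + ε * A.card + c) := by
  have hO' : Overlay G H k (A.erase v) (W.erase v) π :=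
    hO.restrict (Finset.erase_subset v A) fun u => by
      have := @hO.sub u
      simp only [Finset.mem_erase]
      tauto
  have h270 : 270 ≤ potential H W + bonus H W :=
    le_trans (Nat.le_add_left _ _) (hp ∅ (Finset.empty_subset _) fun u hu => by simp at hu)
  have h1 := hB.of_parts hkc hε hO' (Finset.card_erase_lt_of_mem hv)
    (p := potential H W + bonus H W - 270) fun M hM hcl => by
      have := hp M hM hcl
      omega
  refine (h1.insert v).mono ?_
  rw [Nat.cast_sub h270]
  have h2 : ((A.erase v).card : ℝ) ≤ A.card := by
    exact_mod_cast Finset.card_le_card (Finset.erase_subset v A)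
  have h3 := mul_le_mul_of_nonneg_left h2 hε
  push_cast
  linarith

lemma LayoutBound.low_degree (hB : LayoutBound G k ε c W.card) (hkc : (k : ℝ) ≤ c)
    (hε : 0 ≤ ε) (hkε : 4 ≤ ε * k) (hO : Overlay G H k A W π) (hW : IsConn H W) (hv : v ∈ W)
    (hd : degIn H W v ≤ 2) :
    HasLayout G A ((potential H W + bonus H W : ℕ) / 270 + ε * A.card + c) := by
  rcases Nat.lt_or_ge (attached G A W π v).card k with hQ | hQ
  · refine (hB (fill H v) A (W.erase v) _ (Finset.card_erase_lt_of_mem hv) (hO.fill hv hQ)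
      (hW.fill hv)).mono ?_
    have : ((potential (fill H v) (W.erase v) + bonus (fill H v) (W.erase v) : ℕ) : ℝ) ≤
        (potential H W + bonus H W : ℕ) := by exact_mod_cast potential_fill_le hv hd
    linarith
  · set Q := attached G A W π v with hQdef
    set X := insert v (nbrs H W v) with hX
    have hvX : v ∈ X := Finset.mem_insert_self _ _
    have hXW : X ⊆ W := Finset.insert_subset hv (Finset.filter_subset _ _)
    have hX3 : X.card ≤ 3 := (Finset.card_insert_le _ _).trans (by unfold degIn at hd; omega)
    have hQA : Q ⊆ A \ W := Finset.filter_subset _ _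
    have hO' : Overlay G H k ((A \ X) \ Q) (W \ X) π :=
      hO.restrict (Finset.sdiff_subset.trans Finset.sdiff_subset) fun u => by
        have h1 := @hO.sub u
        have h2 := @hQA u
        simp only [Finset.mem_sdiff] at h2 ⊢
        tauto
    have hlt : (W \ X).card < W.card :=
      Finset.card_lt_card (Finset.sdiff_ssubset hXW ⟨v, hvX⟩)
    have h1 := hB.of_parts hkc hε hO' hlt (p := potential H W + 24) fun M hM _ =>
      Nat.add_le_add (potential_mono (hM.trans Finset.sdiff_subset)) (bonus_le H M)
    have h2 : HasLayout G Q
        ((potential H W + 24 : ℕ) / 270 + ε * ((A \ X) \ Q).card + c) := by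
      refine (hO.layout_pieces hQA).mono ?_
      have : (0 : ℝ) ≤ (potential H W + 24 : ℕ) / 270 + ε * ((A \ X) \ Q).card := by positivity
      linarith
    have hQX : Q ⊆ A \ X := hQA.trans (Finset.sdiff_subset_sdiff subset_rfl hXW)
    have h3 := h1.union h2 fun u hu q hq huq => by
      obtain ⟨hu, huQ⟩ := Finset.mem_sdiff.1 hu
      obtain ⟨huA, huX⟩ := Finset.mem_sdiff.1 hu
      obtain ⟨hqA, q', hq', e, hq'v⟩ := mem_attached.1 hq
      by_cases huW : u ∈ W
      · have huv : u ≠ v := fun h => huX (h ▸ hvX)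
        have := hO.clique q hqA q' hq' e.symm u huW v hv huq.symm hq'v huv
        exact huX (Finset.mem_insert_of_mem (mem_nbrs.2 ⟨huW, this.symm⟩))
      · have huA' : u ∈ A \ W := Finset.mem_sdiff.2 ⟨huA, huW⟩
        refine huQ (mem_attached.2 ⟨huA', q', hq', ?_, hq'v⟩)
        rw [e, hO.adj_piece u huA' q hqA huq]
    rw [Finset.sdiff_union_of_subset hQX] at h3
    refine h3.add_card.mono ?_
    have h4 : ((A \ X) \ Q).card + k ≤ A.card := by
      have h5 := Finset.card_sdiff_add_card_eq_card hQX
      have h6 := Finset.card_le_card (Finset.sdiff_subset : A \ X ⊆ A)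
      omega
    have h5 : (((A \ X) \ Q).card + k : ℝ) ≤ A.card := by exact_mod_cast h4
    have h6 := mul_le_mul_of_nonneg_left h5 hε
    have h7 : (X.card : ℝ) ≤ 3 := by exact_mod_cast hX3
    have h8 : (0 : ℝ) ≤ bonus H W := Nat.cast_nonneg _
    push_cast
    linarith

lemma layoutBound (hε : 0 ≤ ε) (hkε : 4 ≤ ε * k) (hc : 0 ≤ c)
    (hcubic : ∀ (H : SimpleGraph V) (W : Finset V), (∀ v ∈ W, degIn H W v = 3) →
      HasLayout H W (W.card / 6 + ε * W.card + c)) (n : ℕ) :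
    LayoutBound G k ε (c + k) n := by
  have hkc : (k : ℝ) ≤ c + k := by linarith
  induction n with
  | zero => exact fun H A W π h => absurd h (Nat.not_lt_zero _)
  | succ n ih =>
    intro H A W π hn hO hW
    have hB : LayoutBound G k ε (c + k) W.card := fun H' A' W' π' h =>
      ih H' A' W' π' (h.trans_le (Nat.le_of_lt_succ hn))
    by_cases h3 : ∀ v ∈ W, 3 ≤ degIn H W v
    · by_cases hcub : ∀ v ∈ W, degIn H W v = 3
      · refine (hO.layout (hcubic H W hcub)).mono ?_
        have h1 : potential H W = W.card * 45 := by
          rw [potential, Finset.sum_congr rfl fun v hv => by rw [hcub v hv]]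
          simp [weight]
        have h2 : (W.card : ℝ) ≤ A.card := by exact_mod_cast Finset.card_le_card hO.sub
        have h4 := mul_le_mul_of_nonneg_left h2 hε
        have h5 : (0 : ℝ) ≤ bonus H W := Nat.cast_nonneg _
        rw [h1]
        push_cast
        linarith
      · obtain ⟨v, hv, hp⟩ := exists_deletion hW h3 hcub
        exact hB.deletion hkc hε hO hv hp
    · push Not at h3
      obtain ⟨v, hv, hd⟩ := h3
      exact hB.low_degree hkc hε hkε hO hW hv (by omega)

/-- Every graph has a layout whose width is bounded in terms of its potential. -/
theorem exists_hasLayout {ε : ℝ} (hε : 0 < ε) :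
    ∃ c : ℝ, 0 ≤ c ∧ ∀ (V : Type) (G : SimpleGraph V) (W : Finset V),
      HasLayout G W (potential G W / 270 + ε * W.card + c) := by
  obtain ⟨c, hc, hcubic⟩ := exists_hasLayout_of_cubic hε
  obtain ⟨k, hk⟩ := exists_nat_ge (4 / ε)
  have hkε : 4 ≤ ε * k := by rwa [div_le_iff₀' hε] at hk
  refine ⟨c + k + 1, by positivity, fun V G W => ?_⟩
  have h := (layoutBound hε.le hkε hc (hcubic V) (W.card + 1)).of_parts (by linarith) hε.le
    (Overlay.refl G k W) (Nat.lt_succ_self _) (p := potential G W + 24) fun M hM _ =>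
      Nat.add_le_add (potential_mono hM) (bonus_le G M)
  refine h.mono ?_
  push_cast
  linarith

end Induction
end Layouts

section Multigraphs

open scoped Classical

variable {V E : Type}

/-- The simple graph underlying a multigraph. -/
def Multigraph.toSimple (ends : E → Sym2 V) : SimpleGraph V where
  Adj u v := u ≠ v ∧ ∃ e, ends e = s(u, v)
  symm := ⟨fun _ _ h => ⟨h.1.symm, h.2.imp fun _ he => he.trans Sym2.eq_swap⟩⟩
  loopless := ⟨fun _ h => h.1 rfl⟩

lemma Sym2.card_toMul (s : Sym2 V) : s.toMul.card = 2 := by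
  induction s with
  | _ a b => rfl

lemma Sym2.mem_toMul {v : V} {s : Sym2 V} : v ∈ s.toMul ↔ v ∈ s := by
  induction s with
  | _ a b => simp [Sym2.toMul]

lemma Multigraph.sum_deg [Fintype V] [DecidableEq V] [Fintype E] (ends : E → Sym2 V) :
    ∑ v, Multigraph.deg ends v = 2 * Fintype.card E := by
  unfold Multigraph.deg
  rw [Finset.sum_comm]
  have : ∀ e ∈ (Finset.univ : Finset E), ∑ v, (ends e).toMul.count v = 2 := fun e _ => by
    rw [Multiset.sum_count_eq_card fun _ _ => Finset.mem_univ _, Sym2.card_toMul]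
  rw [Finset.sum_congr rfl this]
  simp [mul_comm]

lemma Multigraph.degIn_le_deg [DecidableEq V] [Fintype E] (ends : E → Sym2 V) (W : Finset V)
    (v : V) : degIn (Multigraph.toSimple ends) W v ≤ Multigraph.deg ends v := by
  have hedge : ∀ u ∈ nbrs (Multigraph.toSimple ends) W v, ∃ e, ends e = s(v, u) := fun u hu =>
    (mem_nbrs.1 hu).2.2
  rcases (nbrs (Multigraph.toSimple ends) W v).eq_empty_or_nonempty with h0 | ⟨u, hu⟩
  · simp [degIn, h0]
  have : Nonempty E := ⟨(hedge u hu).choose⟩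
  choose! e he using hedge
  have h1 : degIn (Multigraph.toSimple ends) W v ≤
      (Finset.univ.filter fun e => v ∈ ends e).card := by
    refine Finset.card_le_card_of_injOn e (fun u hu => ?_) fun u hu u' hu' h => ?_
    · simp [he u hu]
    · have := he u hu
      rw [h, he u' hu'] at this
      exact (Sym2.congr_right.1 this).symm
  refine h1.trans ?_
  rw [Finset.card_filter]
  refine Finset.sum_le_sum fun e _ => ?_
  split_ifs with h
  · exact Multiset.one_le_count_iff_mem.2 (Sym2.mem_toMul.2 h)
  · exact Nat.zero_le _

lemma Multigraph.pathwidth_le [Fintype V] {ends : E → Sym2 V} {x : ℝ} (hx : 0 ≤ x)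
    (h : HasLayout (Multigraph.toSimple ends) Finset.univ x) :
    (Multigraph.pathwidth ends : ℝ) ≤ x := by
  obtain ⟨f, hf⟩ := h
  have hmem : Multigraph.pathwidth ends ≤ ⌊x⌋₊ := by
    refine Nat.sInf_le ⟨Finset.univ.sup f,
      fun t => bag (Multigraph.toSimple ends) Finset.univ f t, ⟨?_, ?_, ?_⟩, fun t => ?_⟩
    · exact fun v => ⟨⟨f v, Nat.lt_succ_of_le (Finset.le_sup (Finset.mem_univ v))⟩,
        mem_bag.2 ⟨Finset.mem_univ v, Or.inl rfl⟩⟩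
    · intro v a b c hab hbc ha hc
      rw [Fin.le_def] at hab hbc
      rw [mem_bag] at ha hc ⊢
      refine ⟨ha.1, ?_⟩
      have hfa : f v ≤ a := ha.2.elim le_of_eq fun h => h.1.le
      rcases (hfa.trans hab).eq_or_lt with h | h
      · exact Or.inl h
      · refine Or.inr ⟨h, ?_⟩
        rcases hc.2 with hc | ⟨-, u, hu, hadj, hle⟩
        · omega
        · exact ⟨u, hu, hadj, hbc.trans hle⟩
    · have key : ∀ a b, f a ≤ f b → ∀ e, ends e = s(a, b) →
          ∃ t : Fin (Finset.univ.sup f + 1), ∀ u, u ∈ ends e →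
            u ∈ bag (Multigraph.toSimple ends) Finset.univ f t := by
        intro a b hab e he
        refine ⟨⟨f b, Nat.lt_succ_of_le (Finset.le_sup (Finset.mem_univ b))⟩, fun u hu => ?_⟩
        rw [mem_bag]
        refine ⟨Finset.mem_univ u, ?_⟩
        rw [he, Sym2.mem_iff] at hu
        rcases hu with rfl | rfl
        · rcases hab.eq_or_lt with h | h
          · exact Or.inl h
          · refine Or.inr ⟨h, b, Finset.mem_univ b, ⟨?_, e, he⟩, le_rfl⟩
            rintro rfl
            exact lt_irrefl _ h
        · exact Or.inl rfl
      intro e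
      obtain ⟨a, b, he⟩ : ∃ a b, ends e = s(a, b) := by
        induction h : ends e with
        | _ a b => exact ⟨a, b, rfl⟩
      rcases le_total (f a) (f b) with hab | hab
      · exact key a b hab e he
      · exact key b a hab e (he.trans Sym2.eq_swap)
    · exact (Nat.le_floor (hf t)).trans (Nat.le_succ _)
  exact (Nat.cast_le.2 hmem).trans (Nat.floor_le hx)

lemma HasLayout.univ [Fintype V] {G : SimpleGraph V} {deg : V → ℕ} {m : ℕ} {ε c : ℝ}
    (hε : 0 ≤ ε) (hc : 0 ≤ c) (hdeg : ∀ W v, degIn G W v ≤ deg v) (heven : ∀ v, Even (deg v))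
    (hsum : ∑ v, deg v = 2 * m)
    (hlayout : ∀ W, HasLayout G W (potential G W / 270 + ε * W.card + c)) :
    HasLayout G Finset.univ (23 / 135 * m + ε * m + (c + 1)) := by
  set W := Finset.univ.filter fun v => 0 < deg v with hW
  have hsumW : ∑ v ∈ W, deg v ≤ 2 * m :=
    (Finset.sum_le_sum_of_subset (Finset.subset_univ W)).trans hsum.le
  have hcard : W.card ≤ m := by
    have h1 : W.card * 2 ≤ ∑ v ∈ W, deg v :=
      Finset.card_nsmul_le_sum W deg 2 fun v hv => by
        have h2 := (Finset.mem_filter.1 hv).2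
        obtain ⟨d, hd⟩ := heven v
        omega
    omega
  have hpot : potential G W ≤ 46 * m := by
    have h1 : potential G W ≤ ∑ v ∈ W, 23 * deg v :=
      Finset.sum_le_sum fun v _ => weight_le (heven v) (hdeg W v)
    rw [← Finset.mul_sum] at h1
    omega
  have hiso : ∀ u ∈ Finset.univ \ W, ∀ v, ¬ G.Adj u v := fun u hu v h =>
    (Finset.mem_sdiff.1 hu).2 (Finset.mem_filter.2 ⟨Finset.mem_univ u,
      (one_le_degIn (Finset.mem_singleton_self v) h).trans (hdeg {v} u)⟩)
  have h1 : HasLayout G (Finset.univ \ W) (1 : ℕ) :=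
    HasLayout.of_labelling id (fun u hu v _ h => absurd h (hiso u hu v)) fun x =>
      Finset.card_le_one.2 fun a ha b hb =>
        (Finset.mem_filter.1 ha).2.trans (Finset.mem_filter.1 hb).2.symm
  have hp : (potential G W : ℝ) ≤ 46 * m := by exact_mod_cast hpot
  have hw := mul_le_mul_of_nonneg_left (Nat.cast_le (α := ℝ).2 hcard) hε
  rw [← Finset.union_sdiff_of_subset (Finset.subset_univ W)]
  refine ((hlayout W).mono ?_).union (h1.mono ?_) fun u _ v hv h => hiso v hv u h.symm
  · linarith
  · have : (0 : ℝ) ≤ 23 / 135 * m + ε * m := by positivity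
    push_cast
    linarith

end Multigraphs

/-- For every `ε > 0` there exists an integer `m_ε` such that every even multigraph `G`
with `m > m_ε` edges has pathwidth at most `(23/135)·m + ε·m`. -/
theorem pathwidth_even_multigraph :
    ∀ ε : ℝ, 0 < ε → ∃ mε : ℕ,
      ∀ (V E : Type) [Fintype V] [DecidableEq V] [Fintype E] (ends : E → Sym2 V),
        (∀ v : V, Even (Multigraph.deg ends v)) →
        mε < Fintype.card E →
        (Multigraph.pathwidth ends : ℝ) ≤
          (23 / 135) * (Fintype.card E : ℝ) + ε * (Fintype.card E : ℝ) := by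
  intro ε hε
  obtain ⟨c, hc, hlayout⟩ := exists_hasLayout (half_pos hε)
  obtain ⟨N, hN⟩ := exists_nat_ge ((c + 1) / (ε / 2))
  refine ⟨N, fun V E _ _ _ ends heven hm => Multigraph.pathwidth_le (by positivity) ?_⟩
  refine (HasLayout.univ (half_pos hε).le hc (Multigraph.degIn_le_deg ends) heven
    (Multigraph.sum_deg ends) (hlayout V _)).mono ?_
  have h1 : c + 1 ≤ ε / 2 * Fintype.card E := by
    rw [div_le_iff₀' (half_pos hε)] at hN
    refine hN.trans (mul_le_mul_of_nonneg_left ?_ (half_pos hε).le)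
    exact_mod_cast hm.le
  linarith
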